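/- Suppose W, Z ⊆ ℕ satisfy W ≰_T Z. Then every 2-bounded coloring f : [ℕ]^2 → ℕ (of arbitrary complexity, with no computability hypothesis on f) admits an infinite f-rainbow H such that W ≰_T H ⊕ Z. -/

import Mathlib

namespace RRT

/-- Partial functions on ℕ that are recursive in the oracle `O`.
This mirrors `Nat.Partrec`, with an extra constructor for the oracle. -/
inductive RecursiveIn (O : ℕ →. ℕ) : (ℕ →. ℕ) → Prop
  | zero : RecursiveIn O (pure 0)
  | succ : RecursiveIn O Nat.succ
  | left : RecursiveIn O ↑fun n : ℕ => n.unpair.1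
  | right : RecursiveIn O ↑fun n : ℕ => n.unpair.2
  | oracle : RecursiveIn O O
  | pair {f g} : RecursiveIn O f → RecursiveIn O g →
      RecursiveIn O fun n => Nat.pair <$> f n <*> g n
  | comp {f g} : RecursiveIn O f → RecursiveIn O g →
      RecursiveIn O fun n => g n >>= f
  | prec {f g} : RecursiveIn O f → RecursiveIn O g →
      RecursiveIn O (Nat.unpaired fun a n =>
        n.rec (f a) fun y IH => do let i ← IH; g (Nat.pair a (Nat.pair y i)))
  | rfind {f} : RecursiveIn O f →
      RecursiveIn O fun a => Nat.rfind fun n => (fun m => m = 0) <$> f (Nat.pair a n)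

/-- The characteristic function of a set of naturals. -/
noncomputable def chi (A : Set ℕ) : ℕ → ℕ := A.indicator fun _ => 1

/-- Turing reducibility `A ≤_T B` for sets of naturals: the characteristic function of `A`
is computable relative to an oracle for the characteristic function of `B`. -/
def TuringLE (A B : Set ℕ) : Prop := RecursiveIn (chi B) (chi A)

/-- The recursive join `A ⊕ B = {2n : n ∈ A} ∪ {2n+1 : n ∈ B}`. -/
def join (A B : Set ℕ) : Set ℕ :=
  {n : ℕ | (∃ m ∈ A, n = 2 * m) ∨ (∃ m ∈ B, n = 2 * m + 1)}

/-- A total function `f : ℕ → ℕ` is computable relative to an oracle for `Z ⊆ ℕ`. -/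
def FunRecIn (Z : Set ℕ) (f : ℕ → ℕ) : Prop := RecursiveIn (chi Z) f


/-- A coloring of `[ℕ]²` (identified with pairs `(x,y)`, `x < y`) is 2-bounded if
every color has at most 2 preimages. -/
def Bounded2Pairs (f : ℕ → ℕ → ℕ) : Prop :=
  ∀ c : ℕ, {p : ℕ × ℕ | p.1 < p.2 ∧ f p.1 p.2 = c}.encard ≤ 2

/-- `X` is an `f`-rainbow: `f` is injective on `[X]²`. -/
def RainbowOn (f : ℕ → ℕ → ℕ) (X : Set ℕ) : Prop :=
  ∀ x₀ x₁ y₀ y₁ : ℕ, x₀ ∈ X → x₁ ∈ X → y₀ ∈ X → y₁ ∈ X →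
    x₀ < x₁ → y₀ < y₁ → f x₀ x₁ = f y₀ y₁ → x₀ = y₀ ∧ x₁ = y₁

/-- `X` is a tail `f`-rainbow: pairs from `X` with distinct second coordinates get
distinct colors. -/
def TailRainbowOn (f : ℕ → ℕ → ℕ) (X : Set ℕ) : Prop :=
  ∀ x₀ x₁ y₀ y₁ : ℕ, x₀ ∈ X → x₁ ∈ X → y₀ ∈ X → y₁ ∈ X →
    x₀ < x₁ → y₀ < y₁ → x₁ ≠ y₁ → f x₀ x₁ ≠ f y₀ y₁


end RRT

namespace RRT

section Sigma
open Encodable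

variable {ι κ α β γ : Type} [Primcodable ι] [Primcodable κ] [Primcodable α] [Primcodable β]
  [Primcodable γ]

def Compat {ι : Type} (A : ι → Bool) (L : List (ι × Bool)) : Prop := ∀ p ∈ L, A p.1 = p.2

/-- Uniformly `Σ₁` relations between oracles and elements of a coded type. -/
def Sig (S : (ι → Bool) → α → Prop) : Prop :=
  ∃ Q : (List (ι × Bool) × ℕ) × α → Prop, PrimrecPred Q ∧
    ∀ A a, S A a ↔ ∃ w, Q (w, a) ∧ Compat A w.1

theorem Sig.of_witness {S : (ι → Bool) → α → Prop} (Q : β × α → Prop) (hQ : PrimrecPred Q)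
    (lit : β → List (ι × Bool)) (hlit : Primrec lit)
    (h : ∀ A a, S A a ↔ ∃ w, Q (w, a) ∧ Compat A (lit w)) : Sig S := by
  classical
  refine ⟨fun x => (((decode x.1.2 : Option β).map fun w =>
      (decide (Q (w, x.2)) && decide (lit w = x.1.1))).getD false) = true, ?_, ?_⟩
  · refine Primrec.eq.comp ?_ (Primrec.const true)
    refine Primrec.option_getD.comp ?_ (Primrec.const false)
    refine Primrec.option_map (Primrec.decode.comp (Primrec.snd.comp Primrec.fst)) ?_
    refine Primrec.and.comp ?_ ?_
    · exact (PrimrecPred.decide hQ).comp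
        (Primrec.pair Primrec.snd (Primrec.snd.comp Primrec.fst))
    · exact PrimrecPred.decide (Primrec.eq.comp (hlit.comp Primrec.snd)
        (Primrec.fst.comp (Primrec.fst.comp Primrec.fst)))
  · intro A a
    rw [h]
    constructor
    · rintro ⟨w, hw, hc⟩
      exact ⟨(lit w, encode w), by simp [hw], hc⟩
    · rintro ⟨⟨L, k⟩, hw, hc⟩
      simp only at hw hc
      cases hd : (decode k : Option β) with
      | none => simp [hd] at hw
      | some w =>
        simp [hd] at hw
        exact ⟨w, hw.1, hw.2 ▸ hc⟩

theorem Sig.of_eq {S T : (ι → Bool) → α → Prop} (h : Sig S) (e : ∀ A a, S A a ↔ T A a) :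
    Sig T := by
  have : S = T := by funext A a; exact propext (e A a)
  exact this ▸ h

theorem Sig.prim {Q : α → Prop} (hQ : PrimrecPred Q) : Sig (fun (_ : ι → Bool) a => Q a) :=
  Sig.of_witness (β := ℕ) (fun x => Q x.2) (hQ.comp Primrec.snd) (fun _ => [])
    (Primrec.const _) (by intro A a; simp [Compat])

theorem Sig.comp {S : (ι → Bool) → β → Prop} (h : Sig S) {f : α → β} (hf : Primrec f) :
    Sig (fun A a => S A (f a)) := by
  obtain ⟨Q, hQ, h⟩ := h
  exact ⟨fun x => Q (x.1, f x.2),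
    hQ.comp (Primrec.pair Primrec.fst (hf.comp Primrec.snd)), fun A a => h A (f a)⟩

theorem Sig.ex {S : (ι → Bool) → α → β → Prop}
    (h : Sig (fun A (p : α × β) => S A p.1 p.2)) : Sig (fun A a => ∃ b, S A a b) := by
  obtain ⟨Q, hQ, h⟩ := h
  refine Sig.of_witness (β := (List (ι × Bool) × ℕ) × β) (fun x => Q (x.1.1, (x.2, x.1.2)))
    (hQ.comp (Primrec.pair (Primrec.fst.comp Primrec.fst)
      (Primrec.pair Primrec.snd (Primrec.snd.comp Primrec.fst))))
    (fun w => w.1.1) (Primrec.fst.comp Primrec.fst) ?_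
  intro A a
  constructor
  · rintro ⟨b, hb⟩
    obtain ⟨w, hw⟩ := (h A (a, b)).1 hb
    exact ⟨(w, b), hw⟩
  · rintro ⟨⟨w, b⟩, hw⟩
    exact ⟨b, (h A (a, b)).2 ⟨w, hw⟩⟩

theorem Sig.and {S T : (ι → Bool) → α → Prop} (hS : Sig S) (hT : Sig T) :
    Sig (fun A a => S A a ∧ T A a) := by
  obtain ⟨Q, hQ, h⟩ := hS
  obtain ⟨Q', hQ', h'⟩ := hT
  refine Sig.of_witness (β := (List (ι × Bool) × ℕ) × (List (ι × Bool) × ℕ))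
    (fun x => Q (x.1.1, x.2) ∧ Q' (x.1.2, x.2))
    (PrimrecPred.and
      (hQ.comp (Primrec.pair (Primrec.fst.comp Primrec.fst) Primrec.snd))
      (hQ'.comp (Primrec.pair (Primrec.snd.comp Primrec.fst) Primrec.snd)))
    (fun w => w.1.1 ++ w.2.1)
    (Primrec.list_append.comp (Primrec.fst.comp Primrec.fst) (Primrec.fst.comp Primrec.snd)) ?_
  intro A a
  rw [h, h']
  constructor
  · rintro ⟨⟨w, hw, hc⟩, ⟨w', hw', hc'⟩⟩
    refine ⟨(w, w'), ⟨hw, hw'⟩, ?_⟩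
    intro p hp
    rcases List.mem_append.1 hp with hp | hp
    · exact hc p hp
    · exact hc' p hp
  · rintro ⟨⟨w, w'⟩, ⟨hw, hw'⟩, hc⟩
    exact ⟨⟨w, hw, fun p hp => hc p (List.mem_append_left _ hp)⟩,
      ⟨w', hw', fun p hp => hc p (List.mem_append_right _ hp)⟩⟩

theorem Sig.or {S T : (ι → Bool) → α → Prop} (hS : Sig S) (hT : Sig T) :
    Sig (fun A a => S A a ∨ T A a) := by
  obtain ⟨Q, hQ, h⟩ := hS
  obtain ⟨Q', hQ', h'⟩ := hT
  refine ⟨fun x => Q x ∨ Q' x, hQ.or hQ', ?_⟩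
  intro A a
  show (S A a ∨ T A a) ↔ ∃ w, (Q (w, a) ∨ Q' (w, a)) ∧ _
  rw [h, h', ← exists_or]
  refine exists_congr fun w => ?_
  tauto

theorem Sig.atom {f : α → ι} {b : α → Bool} (hf : Primrec f) (hb : Primrec b) :
    Sig (fun A a => A (f a) = b a) := by
  refine Sig.of_witness (β := ι × Bool) (fun x => x.1 = (f x.2, b x.2))
    (Primrec.eq.comp Primrec.fst
      (Primrec.pair (hf.comp Primrec.snd) (hb.comp Primrec.snd)))
    (fun w => [w]) (Primrec.list_cons.comp Primrec.id (Primrec.const [])) ?_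
  intro A a
  simp [Compat]

theorem Sig.forall_mem {S : (ι → Bool) → α → β → Prop} {l : α → List β} (hl : Primrec l)
    (h : Sig (fun A (p : α × β) => S A p.1 p.2)) : Sig (fun A a => ∀ b ∈ l a, S A a b) := by
  obtain ⟨Q, hQ, h⟩ := h
  have h1 : PrimrecRel fun (w : List (ι × Bool) × ℕ) (x : α × β) => Q (w, x) := hQ
  have h2 := h1.exists_mem_list
  have h3 : PrimrecRel fun (b : β) (x : List (List (ι × Bool) × ℕ) × α) =>
      ∃ w ∈ x.1, Q (w, (x.2, b)) :=
    h2.comp (Primrec.fst.comp Primrec.snd)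
      (Primrec.pair (Primrec.snd.comp Primrec.snd) Primrec.fst)
  have h4 := h3.forall_mem_list
  refine Sig.of_witness (β := List (List (ι × Bool) × ℕ))
    (fun x => ∀ b ∈ l x.2, ∃ w ∈ x.1, Q (w, (x.2, b)))
    (h4.comp (hl.comp Primrec.snd) Primrec.id)
    (fun w => w.flatMap Prod.fst)
    (Primrec.list_flatMap Primrec.id (Primrec.fst.comp Primrec.snd)) ?_
  intro A a
  constructor
  · intro H
    choose! w hw using fun b hb => (h A (a, b)).1 (H b hb)
    refine ⟨(l a).map w, ?_, ?_⟩
    · intro b hb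
      exact ⟨w b, List.mem_map_of_mem hb, (hw b hb).1⟩
    · intro p hp
      simp only [List.mem_flatMap, List.mem_map] at hp
      obtain ⟨_, ⟨b, hb, rfl⟩, hp⟩ := hp
      exact (hw b hb).2 p hp
  · rintro ⟨ws, hw, hc⟩ b hb
    obtain ⟨w, hw, hQw⟩ := hw b hb
    refine (h A (a, b)).2 ⟨w, hQw, fun p hp => hc p ?_⟩
    exact List.mem_flatMap.2 ⟨w, hw, hp⟩

/-- Substituting a uniformly computable oracle. -/
theorem Sig.osubst {S : (κ → Bool) → α → Prop} (hS : Sig S)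
    {Φ : (ι → Bool) → α → κ → Bool} 
    (hΦ : Sig (fun A (p : α × (κ × Bool)) => Φ A p.1 p.2.1 = p.2.2)) :
    Sig (fun A a => S (Φ A a) a) := by
  obtain ⟨Q, hQ, h⟩ := hS
  have : Sig (fun (A : ι → Bool) a => ∃ w : List (κ × Bool) × ℕ,
      Q (w, a) ∧ ∀ p ∈ w.1, Φ A a p.1 = p.2) := by
    refine Sig.ex (Sig.and (Sig.prim ?_) (Sig.forall_mem ?_ ?_))
    · exact hQ.comp (Primrec.pair Primrec.snd Primrec.fst)
    · exact Primrec.fst.comp Primrec.snd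
    · exact hΦ.comp (f := fun p : (α × (List (κ × Bool) × ℕ)) × (κ × Bool) => (p.1.1, p.2))
        (Primrec.pair (Primrec.fst.comp Primrec.fst) Primrec.snd)
  exact this.of_eq fun A a => (h _ a).symm

/-- Finite use. -/
theorem Sig.use {S : (ι → Bool) → α → Prop} (hS : Sig S) {A : ι → Bool} {a : α} (h : S A a) :
    ∃ l : List ι, ∀ A' : ι → Bool, (∀ i ∈ l, A' i = A i) → S A' a := by
  obtain ⟨Q, hQ, hS⟩ := hS
  obtain ⟨w, hw, hc⟩ := (hS A a).1 h
  refine ⟨w.1.map Prod.fst, fun A' hA' => (hS A' a).2 ⟨w, hw, fun p hp => ?_⟩⟩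
  rw [hA' p.1 (List.mem_map_of_mem hp), hc p hp]

/-- All boolean lists of given length -/
def allB : ℕ → List (List Bool) :=
  fun n => Nat.rec [[]] (fun _ ls => ls.flatMap fun τ => [true :: τ, false :: τ]) n

theorem mem_allB (n : ℕ) : ∀ τ : List Bool, τ ∈ allB n ↔ τ.length = n := by
  induction n with
  | zero => intro τ; simp [allB]
  | succ n ih =>
    intro τ
    have : allB (n + 1) = (allB n).flatMap fun τ => [true :: τ, false :: τ] := rfl
    rw [this]
    cases τ with
    | nil => simp
    | cons b τ => cases b <;> simp [ih]

theorem allB_primrec : Primrec allB := by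
  refine Primrec.nat_rec₁ _ ?_
  refine Primrec.list_flatMap Primrec.snd ?_
  refine Primrec.list_cons.comp (Primrec.list_cons.comp (Primrec.const true) Primrec.snd) ?_
  exact Primrec.list_cons.comp (Primrec.list_cons.comp (Primrec.const false) Primrec.snd)
    (Primrec.const [])

open Classical in
/-- Ultrafilter limit of a sequence of oracles. -/
noncomputable def ulim {ι : Type} (g : ℕ → ι → Bool) : ι → Bool := fun i =>
  decide (∀ᶠ n in (Filter.hyperfilter ℕ : Filter ℕ), g n i = true)

theorem ulim_spec {ι : Type} (g : ℕ → ι → Bool) (i : ι) :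
    ∀ᶠ n in (Filter.hyperfilter ℕ : Filter ℕ), g n i = ulim g i := by
  by_cases h : ∀ᶠ n in (Filter.hyperfilter ℕ : Filter ℕ), g n i = true
  · have : ulim g i = true := by simp [ulim, h]
    rw [this]; exact h
  · have e : ulim g i = false := by simp only [ulim, h, decide_false]
    rw [e]
    have := Ultrafilter.eventually_not.2 h
    filter_upwards [this] with n hn
    simpa using hn

theorem ulim_spec_list {ι : Type} (g : ℕ → ι → Bool) (l : List ι) :
    ∀ᶠ n in (Filter.hyperfilter ℕ : Filter ℕ), ∀ i ∈ l, g n i = ulim g i := by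
  induction l with
  | nil => simp
  | cons a l ih =>
    filter_upwards [ih, ulim_spec g a] with n h1 h2
    simpa using ⟨h2, h1⟩

theorem hyper_ge (m : ℕ) : ∀ᶠ n in (Filter.hyperfilter ℕ : Filter ℕ), m ≤ n := by
  have : (Filter.hyperfilter ℕ : Filter ℕ) ≤ Filter.atTop := by
    rw [← Nat.cofinite_eq_atTop]; exact Filter.hyperfilter_le_cofinite
  exact this (Filter.eventually_ge_atTop m)

/-- Compactness: universal quantification over oracles. -/
theorem Sig.all {S : (κ ⊕ ι → Bool) → α → Prop} (hS : Sig S) :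
    Sig (fun (A : ι → Bool) a => ∀ g : κ → Bool, S (Sum.elim g A) a) := by
  obtain ⟨Q, hQ, h⟩ := hS
  have hT : Sig (fun (A : ι → Bool) a => ∃ N : ℕ, ∀ τ ∈ allB N,
      ∃ w : List ((κ ⊕ ι) × Bool) × ℕ, Q (w, a) ∧ ∀ p ∈ w.1,
        ((∃ i : κ, p.1 = Sum.inl i ∧ τ[encode i]? = some p.2) ∨
          (∃ j : ι, p.1 = Sum.inr j ∧ A j = p.2))) := by
    refine Sig.ex (Sig.forall_mem (allB_primrec.comp Primrec.snd)
      (Sig.ex (Sig.and (Sig.prim ?_) (Sig.forall_mem (Primrec.fst.comp Primrec.snd)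
        (Sig.or (Sig.ex (Sig.prim ?_)) (Sig.ex (Sig.and (Sig.prim ?_) (Sig.atom ?_ ?_))))))))
    · exact hQ.comp (Primrec.pair Primrec.snd
        (Primrec.fst.comp (Primrec.fst.comp Primrec.fst)))
    · refine PrimrecPred.and ?_ ?_
      · exact Primrec.eq.comp (Primrec.fst.comp (Primrec.snd.comp Primrec.fst))
          (Primrec.sumInl.comp Primrec.snd)
      · refine Primrec.eq.comp (Primrec.list_getElem?.comp ?_ (Primrec.encode.comp Primrec.snd))
          (Primrec.option_some.comp (Primrec.snd.comp (Primrec.snd.comp Primrec.fst)))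
        exact Primrec.snd.comp (Primrec.fst.comp (Primrec.fst.comp Primrec.fst))
    · exact Primrec.eq.comp (Primrec.fst.comp (Primrec.snd.comp Primrec.fst))
          (Primrec.sumInr.comp Primrec.snd)
    · exact Primrec.snd
    · exact Primrec.snd.comp (Primrec.snd.comp Primrec.fst)
  refine hT.of_eq fun A a => ?_
  constructor
  · rintro ⟨N, hN⟩ g
    let τ : List Bool := (List.range N).map fun n =>
      match (decode n : Option κ) with
      | some i => g i
      | none => false
    obtain ⟨w, hw, hp⟩ := hN τ ((mem_allB _ _).2 (by simp [τ]))
    refine (h _ a).2 ⟨w, hw, fun p hpw => ?_⟩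
    rcases hp p hpw with ⟨i, hi, hτ⟩ | ⟨j, hj, hA⟩
    · rw [hi, Sum.elim_inl]
      simp only [τ, List.getElem?_map, Option.map_eq_some_iff] at hτ
      obtain ⟨n, hn, hτ⟩ := hτ
      rw [List.getElem?_eq_some_iff] at hn
      obtain ⟨hn1, hn⟩ := hn
      simp only [List.getElem_range] at hn
      rw [← hn] at hτ
      simpa using hτ
    · rw [hj, Sum.elim_inr]; exact hA
  · intro H
    by_contra hcon
    push Not at hcon
    choose τ hτ hbad using hcon
    let g : ℕ → κ → Bool := fun n i => (τ n)[encode i]?.getD false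
    obtain ⟨w, hw, hc⟩ := (h _ a).1 (H (ulim g))
    let l : List κ := w.1.filterMap fun p => p.1.getLeft?
    have h1 := ulim_spec_list g l
    have h2 : ∃ M : ℕ, ∀ i ∈ l, encode i < M := by
      refine ⟨(l.map encode).sum + 1, fun i hi => ?_⟩
      have := List.single_le_sum (l := l.map encode) (by simp) (encode i)
        (List.mem_map_of_mem hi)
      omega
    obtain ⟨M, hM⟩ := h2
    obtain ⟨n, hn1, hn2⟩ := (h1.and (hyper_ge M)).exists
    obtain ⟨p, hp, hp1, hp2⟩ := hbad n w hw
    have hcp := hc p hp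
    rcases hpp : p.1 with i | j
    · have hil : i ∈ l := List.mem_filterMap.2 ⟨p, hp, by simp [hpp]⟩
      refine hp1 i hpp ?_
      have hlen : encode i < (τ n).length := by
        rw [(mem_allB _ _).1 (hτ n)]; exact lt_of_lt_of_le (hM i hil) hn2
      have := hn1 i hil
      rw [hpp, Sum.elim_inl] at hcp
      rw [← hcp, ← this]
      simp [g, List.getElem?_eq_getElem hlen]
    · refine hp2 j hpp ?_
      rw [hpp, Sum.elim_inr] at hcp
      exact hcp

end Sigma
end RRT

namespace RRT

section Bridge
open Encodable

open Classical in
noncomputable def bo (A : Set ℕ) : ℕ → Bool := fun n => decide (n ∈ A)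

theorem chi_eq (A : Set ℕ) (n : ℕ) : chi A n = (bo A n).toNat := by
  by_cases h : n ∈ A <;> simp [chi, bo, h]

theorem recIn_sig {A : Set ℕ} {f : ℕ →. ℕ} (hf : RecursiveIn (chi A) f) :
    ∃ S : (ℕ → Bool) → ℕ × ℕ → Prop, Sig S ∧ ∀ n b, b ∈ f n ↔ S (bo A) (n, b) := by
  induction hf with
  | zero =>
    refine ⟨fun _ p => p.2 = 0, Sig.prim (Primrec.eq.comp Primrec.snd (Primrec.const 0)), ?_⟩
    intro n b
    exact Part.mem_some_iff
  | succ =>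
    refine ⟨fun _ p => p.2 = p.1 + 1, Sig.prim
      (Primrec.eq.comp Primrec.snd (Primrec.succ.comp Primrec.fst)), ?_⟩
    intro n b
    exact Part.mem_some_iff
  | left =>
    refine ⟨fun _ p => p.2 = p.1.unpair.1, Sig.prim
      (Primrec.eq.comp Primrec.snd (Primrec.fst.comp (Primrec.unpair.comp Primrec.fst))), ?_⟩
    intro n b
    exact Part.mem_some_iff
  | right =>
    refine ⟨fun _ p => p.2 = p.1.unpair.2, Sig.prim
      (Primrec.eq.comp Primrec.snd (Primrec.snd.comp (Primrec.unpair.comp Primrec.fst))), ?_⟩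
    intro n b
    exact Part.mem_some_iff
  | oracle =>
    refine ⟨fun B p => (B p.1 = true ∧ p.2 = 1) ∨ (B p.1 = false ∧ p.2 = 0), ?_, ?_⟩
    · exact Sig.or
        (Sig.and (Sig.atom Primrec.fst (Primrec.const true))
          (Sig.prim (Primrec.eq.comp Primrec.snd (Primrec.const 1))))
        (Sig.and (Sig.atom Primrec.fst (Primrec.const false))
          (Sig.prim (Primrec.eq.comp Primrec.snd (Primrec.const 0))))
    · intro n b
      refine Iff.trans Part.mem_some_iff ?_
      rw [chi_eq]
      show _ ↔ (bo A n = true ∧ b = 1) ∨ (bo A n = false ∧ b = 0)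
      cases h : bo A n <;> simp
  | @pair f g _ _ ihf ihg =>
    obtain ⟨S, hS, hf⟩ := ihf
    obtain ⟨T, hT, hg⟩ := ihg
    refine ⟨fun B p => ∃ c : ℕ × ℕ, p.2 = Nat.pair c.1 c.2 ∧ S B (p.1, c.1) ∧ T B (p.1, c.2),
      ?_, ?_⟩
    · refine Sig.ex (Sig.and (Sig.prim ?_) (Sig.and ?_ ?_))
      · exact Primrec.eq.comp (Primrec.snd.comp Primrec.fst)
          (Primrec₂.natPair.comp (Primrec.fst.comp Primrec.snd) (Primrec.snd.comp Primrec.snd))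
      · exact hS.comp (Primrec.pair (Primrec.fst.comp Primrec.fst) (Primrec.fst.comp Primrec.snd))
      · exact hT.comp (Primrec.pair (Primrec.fst.comp Primrec.fst) (Primrec.snd.comp Primrec.snd))
    · intro n b
      simp only [← hf, ← hg, Prod.exists]
      simp only [Seq.seq, Part.bind_eq_bind, Part.map_eq_map, Part.mem_bind_iff, Part.mem_map_iff]
      constructor
      · rintro ⟨_, ⟨x, hx, rfl⟩, y, hy, rfl⟩
        exact ⟨x, y, rfl, hx, hy⟩
      · rintro ⟨x, y, rfl, hx, hy⟩
        exact ⟨_, ⟨x, hx, rfl⟩, y, hy, rfl⟩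
  | @comp f g _ _ ihf ihg =>
    obtain ⟨S, hS, hf⟩ := ihf
    obtain ⟨T, hT, hg⟩ := ihg
    refine ⟨fun B p => ∃ c : ℕ, T B (p.1, c) ∧ S B (c, p.2), ?_, ?_⟩
    · refine Sig.ex (Sig.and ?_ ?_)
      · exact hT.comp (Primrec.pair (Primrec.fst.comp Primrec.fst) Primrec.snd)
      · exact hS.comp (Primrec.pair Primrec.snd (Primrec.snd.comp Primrec.fst))
    · intro n b
      refine Iff.trans Part.mem_bind_iff ?_
      simp only [← hf, ← hg]
  | @prec f g _ _ ihf ihg =>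
    obtain ⟨S, hS, hf⟩ := ihf
    obtain ⟨T, hT, hg⟩ := ihg
    refine ⟨fun B p => ∃ vs : List ℕ, S B (p.1.unpair.1, vs.getD 0 0) ∧
      (∀ y ∈ List.range p.1.unpair.2,
        T B (Nat.pair p.1.unpair.1 (Nat.pair y (vs.getD y 0)), vs.getD (y + 1) 0)) ∧
      p.2 = vs.getD p.1.unpair.2 0, ?_, ?_⟩
    · refine Sig.ex (Sig.and ?_ (Sig.and (Sig.forall_mem ?_ ?_) (Sig.prim ?_)))
      · refine hS.comp (Primrec.pair ?_ ?_)
        · exact Primrec.fst.comp (Primrec.unpair.comp (Primrec.fst.comp Primrec.fst))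
        · exact (Primrec.list_getD 0).comp Primrec.snd (Primrec.const 0)
      · exact Primrec.list_range.comp
          (Primrec.snd.comp (Primrec.unpair.comp (Primrec.fst.comp Primrec.fst)))
      · refine hT.comp (Primrec.pair (Primrec₂.natPair.comp ?_ (Primrec₂.natPair.comp ?_ ?_)) ?_)
        · exact Primrec.fst.comp (Primrec.unpair.comp
            (Primrec.fst.comp (Primrec.fst.comp Primrec.fst)))
        · exact Primrec.snd
        · exact (Primrec.list_getD 0).comp (Primrec.snd.comp Primrec.fst) Primrec.snd
        · exact (Primrec.list_getD 0).comp (Primrec.snd.comp Primrec.fst)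
            (Primrec.succ.comp Primrec.snd)
      · exact Primrec.eq.comp (Primrec.snd.comp Primrec.fst)
          ((Primrec.list_getD 0).comp Primrec.snd
            (Primrec.snd.comp (Primrec.unpair.comp (Primrec.fst.comp Primrec.fst))))
    · intro n b
      simp only [← hf, ← hg, Nat.unpaired]
      generalize n.unpair.1 = a
      generalize n.unpair.2 = m
      induction m generalizing b with
      | zero =>
        simp only [List.range_zero]
        constructor
        · intro h
          exact ⟨[b], h, by simp, rfl⟩
        · rintro ⟨vs, h, -, rfl⟩
          exact h
      | succ m ih =>
        simp only [Part.bind_eq_bind, Part.mem_bind_iff]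
        constructor
        · rintro ⟨i, hi, hb⟩
          obtain ⟨vs, h0, h1, rfl⟩ := (ih i).1 hi
          refine ⟨(List.range (m + 1)).map (fun j => vs.getD j 0) ++ [b], ?_, ?_, ?_⟩
          · simpa [List.getD_eq_getElem?_getD, List.getElem?_append] using h0
          · intro y hy
            have hy' : y < m + 1 := List.mem_range.1 hy
            have e1 : ((List.range (m + 1)).map (fun j => vs.getD j 0) ++ [b]).getD y 0
                = vs.getD y 0 := by
              simp [List.getD_eq_getElem?_getD, List.getElem?_append, hy']
            rw [e1]
            by_cases hym : y < m
            · have e2 : ((List.range (m + 1)).map (fun j => vs.getD j 0) ++ [b]).getD (y+1) 0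
                  = vs.getD (y+1) 0 := by
                simp [List.getD_eq_getElem?_getD, List.getElem?_append, hym]
              rw [e2]
              exact h1 y (List.mem_range.2 hym)
            · have : y = m := by omega
              subst this
              simpa [List.getD_eq_getElem?_getD, List.getElem?_append] using hb
          · simp [List.getD_eq_getElem?_getD, List.getElem?_append]
        · rintro ⟨vs, h0, h1, rfl⟩
          refine ⟨vs.getD m 0, (ih _).2 ⟨vs, h0, ?_, rfl⟩, h1 m (by simp)⟩
          intro y hy
          refine h1 y ?_
          simp only [List.mem_range] at hy ⊢
          omega
  | @rfind f _ ihf =>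
    obtain ⟨S, hS, hf⟩ := ihf
    refine ⟨fun B p => S B (Nat.pair p.1 p.2, 0) ∧ ∀ m ∈ List.range p.2, ∃ v : ℕ,
      v ≠ 0 ∧ S B (Nat.pair p.1 m, v), ?_, ?_⟩
    · refine Sig.and (hS.comp (Primrec.pair (Primrec₂.natPair.comp Primrec.fst Primrec.snd)
        (Primrec.const 0))) (Sig.forall_mem (Primrec.list_range.comp Primrec.snd)
        (Sig.ex (Sig.and (Sig.prim ?_) (hS.comp (Primrec.pair (Primrec₂.natPair.comp ?_ ?_) ?_)))))
      · exact PrimrecPred.not (Primrec.eq.comp Primrec.snd (Primrec.const 0))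
      · exact Primrec.fst.comp (Primrec.fst.comp Primrec.fst)
      · exact Primrec.snd.comp Primrec.fst
      · exact Primrec.snd
    · intro n b
      refine Iff.trans Nat.mem_rfind ?_
      simp only [← hf, Part.map_eq_map, Part.mem_map_iff, List.mem_range]
      simp only [decide_eq_true_eq, decide_eq_false_iff_not, exists_eq_right, ne_eq]
      refine and_congr Iff.rfl (forall_congr' fun m => imp_congr Iff.rfl ?_)
      exact exists_congr fun v => And.comm

theorem partrec_recIn {O : ℕ →. ℕ} {f : ℕ →. ℕ} (hf : Nat.Partrec f) : RecursiveIn O f := by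
  induction hf with
  | zero => exact .zero
  | succ => exact .succ
  | left => exact .left
  | right => exact .right
  | pair _ _ h1 h2 => exact .pair h1 h2
  | comp _ _ h1 h2 => exact .comp h1 h2
  | prec _ _ h1 h2 => exact .prec h1 h2
  | rfind _ h => exact .rfind h

def Tot (O : ℕ →. ℕ) (f : ℕ → ℕ) : Prop := RecursiveIn O (f : ℕ →. ℕ)

theorem Tot.prim {O : ℕ →. ℕ} {f : ℕ → ℕ} (hf : Primrec f) : Tot O f :=
  partrec_recIn (Nat.Partrec.of_primrec (Primrec.nat_iff.1 hf))

theorem Tot.comp {O : ℕ →. ℕ} {f g : ℕ → ℕ} (hf : Tot O f) (hg : Tot O g) :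
    Tot O (fun n => f (g n)) := by
  have := RecursiveIn.comp hf hg
  have e : ((fun n => f (g n) : ℕ → ℕ) : ℕ →. ℕ) =
      fun n => (g : ℕ →. ℕ) n >>= (f : ℕ →. ℕ) := by
    funext n; exact (Part.bind_some (g n) (f : ℕ →. ℕ)).symm
  unfold Tot
  rw [e]; exact this

theorem Tot.pair {O : ℕ →. ℕ} {f g : ℕ → ℕ} (hf : Tot O f) (hg : Tot O g) :
    Tot O (fun n => Nat.pair (f n) (g n)) := by
  have := RecursiveIn.pair hf hg
  have e : ((fun n => Nat.pair (f n) (g n) : ℕ → ℕ) : ℕ →. ℕ) =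
      fun n => Nat.pair <$> (f : ℕ →. ℕ) n <*> (g : ℕ →. ℕ) n := by
    funext n; simp [PFun.coe_val, Seq.seq]
  unfold Tot
  rw [e]; exact this

noncomputable def pre (B : ℕ → Bool) (l : ℕ) : List Bool := (List.range l).map B

theorem pre_succ (B : ℕ → Bool) (l : ℕ) : pre B (l + 1) = pre B l ++ [B l] := by
  simp [pre, List.range_succ]

theorem tot_pre (A : Set ℕ) : Tot (chi A) (fun l => encode (pre (bo A) l)) := by
  let step : ℕ → ℕ := fun z => 
    encode (((decode z.unpair.1.unpair.2.unpair.2 : Option (List Bool)).getD []) ++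
      [decide (z.unpair.2 = 1)])
  have hstep : Primrec step := by
    refine Primrec.encode.comp (Primrec.list_append.comp (Primrec.option_getD.comp
      (Primrec.decode.comp ?_) (Primrec.const [])) (Primrec.list_cons.comp ?_ (Primrec.const [])))
    · exact Primrec.snd.comp (Primrec.unpair.comp (Primrec.snd.comp (Primrec.unpair.comp
        (Primrec.fst.comp Primrec.unpair))))
    · exact PrimrecPred.decide (Primrec.eq.comp (Primrec.snd.comp Primrec.unpair)
        (Primrec.const 1))
  have h2 : Tot (chi A) (fun x => step (Nat.pair x (chi A x.unpair.2.unpair.1))) := by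
    refine (Tot.prim hstep).comp (Tot.pair (Tot.prim Primrec.id) 
      (Tot.comp (f := chi A) RecursiveIn.oracle (Tot.prim ?_)))
    exact Primrec.fst.comp (Primrec.unpair.comp (Primrec.snd.comp Primrec.unpair))
  have h1 : Tot (chi A) (fun _ => encode ([] : List Bool)) := Tot.prim (Primrec.const _)
  have h3 := RecursiveIn.prec h1 h2
  have h4 : Tot (chi A) (fun x => encode (pre (bo A) x.unpair.2)) := by
    unfold Tot
    refine Eq.mp (congrArg _ ?_) h3
    symm
    funext x
    simp only [Nat.unpaired, PFun.coe_val]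
    generalize x.unpair.1 = a
    generalize x.unpair.2 = m
    induction m with
    | zero => simp [pre]
    | succ m ih =>
      refine Eq.trans ?_ (congrArg (fun q => Part.bind q _) ih)
      rw [Part.bind_some]
      simp only [step, Nat.unpair_pair, encodek, Option.getD_some, chi_eq, pre_succ]
      cases bo A m <;> simp
  have := h4.comp (Tot.prim (f := fun l => Nat.pair 0 l)
    (Primrec₂.natPair.comp (Primrec.const 0) Primrec.id))
  simpa using this

theorem sig_turingLE {A W : Set ℕ} {S : (ℕ → Bool) → ℕ × Bool → Prop} (hS : Sig S)
    (h : ∀ n b, S (bo A) (n, b) ↔ bo W n = b) : TuringLE W A := by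
  classical
  obtain ⟨Q, hQ, hS⟩ := hS
  -- k = pair ℓ (encode (w, b))
  let good : ℕ × List Bool → ((List (ℕ × Bool) × ℕ) × Bool) → Prop := fun x v =>
    Q (v.1, (x.1, v.2)) ∧ ∀ p ∈ v.1.1, x.2[p.1]? = some p.2
  have hgood : PrimrecPred fun z : (ℕ × List Bool) × ((List (ℕ × Bool) × ℕ) × Bool) => good z.1 z.2 := by
    refine PrimrecPred.and ?_ ?_
    · exact hQ.comp (Primrec.pair (Primrec.fst.comp Primrec.snd)
        (Primrec.pair (Primrec.fst.comp Primrec.fst) (Primrec.snd.comp Primrec.snd)))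
    · have : PrimrecRel fun (p : ℕ × Bool) (x : List Bool) => x[p.1]? = some p.2 :=
        Primrec.eq.comp (Primrec.list_getElem?.comp Primrec.snd (Primrec.fst.comp Primrec.fst))
          (Primrec.option_some.comp (Primrec.snd.comp Primrec.fst))
      exact this.forall_mem_list.comp (Primrec.fst.comp (Primrec.fst.comp Primrec.snd))
        (Primrec.snd.comp Primrec.fst)
  -- test on pair (pair n k) (encode pre)
  let test : ℕ → ℕ := fun z => 
    (((decode z.unpair.2 : Option (List Bool)).bind fun x =>
      (decode z.unpair.1.unpair.2.unpair.2 : Option ((List (ℕ × Bool) × ℕ) × Bool)).map fun v =>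
        if good (z.unpair.1.unpair.1, x) v then 0 else 1).getD 1)
  have htest : Primrec test := by
    have h0 : Primrec₂ fun (q : ℕ × List Bool) (v : (List (ℕ × Bool) × ℕ) × Bool) =>
        (if good (q.1.unpair.1.unpair.1, q.2) v then 0 else 1 : ℕ) := by
      have hp : Primrec fun p : (ℕ × List Bool) × ((List (ℕ × Bool) × ℕ) × Bool) =>
          ((p.1.1.unpair.1.unpair.1, p.1.2), p.2) := by
        refine Primrec.pair (Primrec.pair ?_ ?_) Primrec.snd
        · exact Primrec.fst.comp (Primrec.unpair.comp (Primrec.fst.comp (Primrec.unpair.comp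
            (Primrec.fst.comp Primrec.fst))))
        · exact Primrec.snd.comp Primrec.fst
      exact Primrec.ite (hgood.comp hp) (Primrec.const 0) (Primrec.const 1)
    have h1 : Primrec fun q : ℕ × List Bool =>
        (decode q.1.unpair.1.unpair.2.unpair.2 : Option ((List (ℕ × Bool) × ℕ) × Bool)) :=
      Primrec.decode.comp (Primrec.snd.comp (Primrec.unpair.comp (Primrec.snd.comp
        (Primrec.unpair.comp (Primrec.fst.comp (Primrec.unpair.comp Primrec.fst))))))
    have h2 : Primrec fun z : ℕ => (decode z.unpair.2 : Option (List Bool)) :=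
      Primrec.decode.comp (Primrec.snd.comp Primrec.unpair)
    exact Primrec.option_getD.comp (Primrec.option_bind h2 (Primrec.option_map h1 h0))
      (Primrec.const 1)
  have hT : Tot (chi A) (fun y => test (Nat.pair y (encode (pre (bo A) y.unpair.2.unpair.1)))) := by
    refine (Tot.prim htest).comp (Tot.pair (Tot.prim Primrec.id) ((tot_pre A).comp (Tot.prim ?_)))
    exact Primrec.fst.comp (Primrec.unpair.comp (Primrec.snd.comp Primrec.unpair))
  let out : ℕ → ℕ := fun k => ((decode k.unpair.2 : Option ((List (ℕ × Bool) × ℕ) × Bool)).map fun v => v.2.toNat).getD 0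
  have hout : Primrec out := by
    refine Primrec.option_getD.comp (Primrec.option_map (Primrec.decode.comp
      (Primrec.snd.comp Primrec.unpair)) ?_) (Primrec.const 0)
    exact (Primrec.dom_finite Bool.toNat).comp (Primrec.snd.comp Primrec.snd)
  have hR := RecursiveIn.comp (Tot.prim (O := chi A) hout) (RecursiveIn.rfind hT)
  unfold TuringLE
  refine Eq.mp (congrArg _ ?_) hR
  funext n
  rw [PFun.coe_val, Part.eq_some_iff]
  have key : ∀ k, test (Nat.pair (Nat.pair n k) (encode (pre (bo A) k.unpair.1))) = 0 →
      out k = chi W n := by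
    intro k hk
    simp only [test, Nat.unpair_pair, encodek, Option.bind_some] at hk
    cases hd : (decode k.unpair.2 : Option ((List (ℕ × Bool) × ℕ) × Bool)) with
    | none => simp [hd] at hk
    | some v =>
      simp only [hd, Option.map_some, Option.getD_some, ite_eq_left_iff, one_ne_zero,
        imp_false, not_not] at hk
      have : S (bo A) (n, v.2) := by
        refine (hS _ _).2 ⟨v.1, hk.1, fun p hp => ?_⟩
        have := hk.2 p hp
        simp only [pre, List.getElem?_map, Option.map_eq_some_iff,
          List.getElem?_eq_some_iff, List.getElem_range] at this
        obtain ⟨m, ⟨_, rfl⟩, hm⟩ := this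
        exact hm
      simp only [out]
      rw [hd, chi_eq, (h n v.2).1 this]
      rfl
  have ex : ∃ k, test (Nat.pair (Nat.pair n k) (encode (pre (bo A) k.unpair.1))) = 0 := by
    obtain ⟨w, hw, hc⟩ := (hS _ _).1 ((h n (bo W n)).2 rfl)
    let l := (w.1.map fun p => p.1).sum + 1
    refine ⟨Nat.pair l (encode ((w, bo W n) : ((List (ℕ × Bool) × ℕ) × Bool))), ?_⟩
    simp only [test, Nat.unpair_pair, encodek, Option.bind_some, Option.map_some,
      Option.getD_some, ite_eq_left_iff, one_ne_zero, imp_false, not_not]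
    refine ⟨hw, fun p hp => ?_⟩
    have hlt : p.1 < l := by
      have := List.single_le_sum (l := w.1.map fun p => p.1) (by simp) p.1
        (List.mem_map_of_mem (f := fun p => p.1) hp)
      simp only [l]
      omega
    simp [pre, hlt, hc p hp]
  obtain ⟨k0, hk0, hmin⟩ : ∃ k, test (Nat.pair (Nat.pair n k)
      (encode (pre (bo A) k.unpair.1))) = 0 ∧ ∀ m < k, test (Nat.pair (Nat.pair n m)
      (encode (pre (bo A) m.unpair.1))) ≠ 0 :=
    ⟨Nat.find ex, Nat.find_spec ex, fun m hm => Nat.find_min ex hm⟩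
  refine Part.mem_bind_iff.2 ?_
  refine ⟨k0, ?_, ?_⟩
  · refine Nat.mem_rfind.2 ?_
    simp only [PFun.coe_val, Nat.unpair_pair]
    constructor
    · simp [hk0]
    · intro m hm
      simpa using hmin m hm
  · rw [PFun.coe_val, key k0 hk0]
    exact Part.mem_some _

theorem countable_sig {ι α : Type} [Primcodable ι] [Primcodable α] :
    {S : (ι → Bool) → α → Prop | Sig S}.Countable := by
  have hP : {Q : (List (ι × Bool) × ℕ) × α → Prop | PrimrecPred Q}.Countable := by
    let F : Nat.Partrec.Code → ((List (ι × Bool) × ℕ) × α → Prop) := fun c x =>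
      encode (some true) ∈ c.eval (encode x)
    refine (Set.countable_range F).mono ?_
    rintro Q ⟨hd, hQ⟩
    obtain ⟨c, hc⟩ := Nat.Partrec.Code.exists_code.1 (Nat.Partrec.of_primrec hQ)
    refine ⟨c, ?_⟩
    funext x
    simp only [F, hc, PFun.coe_val, encodek, Option.map_some, Part.mem_some_iff]
    by_cases hx : Q x <;> simp [hx]
  refine (hP.image fun Q (A : ι → Bool) a => ∃ w, Q (w, a) ∧ Compat A w.1).mono ?_
  rintro S ⟨Q, hQ, h⟩
  refine ⟨Q, hQ, ?_⟩
  funext A a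
  exact propext (h A a).symm

theorem exists_enum_sig {ι α : Type} [Primcodable ι] [Primcodable α] :
    ∃ e : ℕ → (ι → Bool) → α → Prop, (∀ n, Sig (e n)) ∧ ∀ S, Sig S → ∃ n, e n = S := by
  have hne : {S : (ι → Bool) → α → Prop | Sig S}.Nonempty :=
    ⟨fun _ _ => True, Sig.prim (Q := fun _ : α => True) ⟨fun _ => instDecidableTrue, by
      simpa using Primrec.const true⟩⟩
  obtain ⟨e, he⟩ := countable_sig.exists_eq_range hne
  refine ⟨e, fun n => ?_, fun S hS => ?_⟩
  · have : e n ∈ Set.range e := ⟨n, rfl⟩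
    rw [← he] at this; exact this
  · have : S ∈ Set.range e := he ▸ hS
    exact this

end Bridge
end RRT

namespace RRT

section Cone
open Encodable

variable {ι κ α β : Type} [Primcodable ι] [Primcodable κ] [Primcodable α] [Primcodable β]

/-- The oracle `A` does not compute `w`. -/
def Good (w : ℕ → Bool) (A : ι → Bool) : Prop :=
  ∀ S : (ι → Bool) → ℕ × Bool → Prop, Sig S → ¬ ∀ n b, S A (n, b) ↔ w n = b

theorem Good.dich {w : ℕ → Bool} {A : ι → Bool} (hA : Good w A)
    {T : (ι → Bool) → ℕ × Bool → Prop} (hT : Sig T) :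
    (∃ n b, T A (n, b) ∧ w n ≠ b) ∨ ∃ n, ¬ T A (n, w n) := by
  by_contra hcon
  rw [not_or] at hcon
  obtain ⟨h1, h2⟩ := hcon
  refine hA T hT fun n b => ⟨fun h => ?_, fun h => ?_⟩
  · by_contra hne
    exact h1 ⟨n, b, h, hne⟩
  · by_contra hne
    exact h2 ⟨n, h ▸ hne⟩

theorem Good.map {w : ℕ → Bool} {A : ι → Bool} (hA : Good w A) (Φ : (ι → Bool) → κ → Bool)
    (hΦ : Sig (fun A (p : κ × Bool) => Φ A p.1 = p.2)) : Good w (Φ A) := by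
  intro S hS hcon
  refine hA (fun A a => S (Φ A) a) ?_ hcon
  exact Sig.osubst (Φ := fun A _ => Φ A) hS (hΦ.comp Primrec.snd)

theorem Sig.sumElim {κ₁ κ₂ : Type} [Primcodable κ₁] [Primcodable κ₂]
    {f : (ι → Bool) → α → κ₁ → Bool} {g : (ι → Bool) → α → κ₂ → Bool}
    (hf : Sig (fun A (p : α × (κ₁ × Bool)) => f A p.1 p.2.1 = p.2.2))
    (hg : Sig (fun A (p : α × (κ₂ × Bool)) => g A p.1 p.2.1 = p.2.2)) :
    Sig (fun A (p : α × ((κ₁ ⊕ κ₂) × Bool)) => Sum.elim (f A p.1) (g A p.1) p.2.1 = p.2.2) := by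
  have h1 : Sig (fun (A : ι → Bool) (p : α × ((κ₁ ⊕ κ₂) × Bool)) => ∃ i : κ₁,
      p.2.1 = Sum.inl i ∧ f A p.1 i = p.2.2) := by
    refine Sig.ex (Sig.and (Sig.prim ?_) (hf.comp (f := fun q : (α × ((κ₁ ⊕ κ₂) × Bool)) × κ₁ =>
      (q.1.1, (q.2, q.1.2.2))) ?_))
    · exact Primrec.eq.comp (Primrec.fst.comp (Primrec.snd.comp Primrec.fst))
        (Primrec.sumInl.comp Primrec.snd)
    · exact Primrec.pair (Primrec.fst.comp Primrec.fst) (Primrec.pair Primrec.snd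
        (Primrec.snd.comp (Primrec.snd.comp Primrec.fst)))
  have h2 : Sig (fun (A : ι → Bool) (p : α × ((κ₁ ⊕ κ₂) × Bool)) => ∃ i : κ₂,
      p.2.1 = Sum.inr i ∧ g A p.1 i = p.2.2) := by
    refine Sig.ex (Sig.and (Sig.prim ?_) (hg.comp (f := fun q : (α × ((κ₁ ⊕ κ₂) × Bool)) × κ₂ =>
      (q.1.1, (q.2, q.1.2.2))) ?_))
    · exact Primrec.eq.comp (Primrec.fst.comp (Primrec.snd.comp Primrec.fst))
        (Primrec.sumInr.comp Primrec.snd)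
    · exact Primrec.pair (Primrec.fst.comp Primrec.fst) (Primrec.pair Primrec.snd
        (Primrec.snd.comp (Primrec.snd.comp Primrec.fst)))
  refine (h1.or h2).of_eq ?_
  rintro A ⟨a, k | k, b⟩ <;> simp

theorem primrec_mem : PrimrecRel fun (a : ℕ) (l : List ℕ) => a ∈ l := by
  have h : PrimrecRel fun (x : ℕ) (a : ℕ) => x = a := Primrec.eq
  have h2 := h.exists_mem_list
  have h3 : PrimrecRel fun (a : ℕ) (l : List ℕ) => ∃ x ∈ l, x = a :=
    h2.comp Primrec.snd Primrec.fst
  have e : (fun (a : ℕ) (l : List ℕ) => ∃ x ∈ l, x = a) = fun a l => a ∈ l := by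
    funext a l; simp
  rw [e] at h3
  exact h3

/-- characteristic function of a list -/
def lst (F : List ℕ) : ℕ → Bool := fun n => decide (n ∈ F)

theorem lst_iff {F : List ℕ} {n : ℕ} : lst F n = true ↔ n ∈ F := by simp [lst]

theorem sig_lst {L : α → List ℕ} (hL : Primrec L) :
    Sig (fun (_ : ι → Bool) (p : α × (ℕ × Bool)) => lst (L p.1) p.2.1 = p.2.2) := by
  refine Sig.prim (Primrec.eq.comp ?_ (Primrec.snd.comp Primrec.snd))
  have h : PrimrecPred fun p : α × (ℕ × Bool) => p.2.1 ∈ L p.1 :=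
    primrec_mem.comp (Primrec.fst.comp Primrec.snd) (hL.comp Primrec.fst)
  exact h.decide

theorem sig_fin {S : (ℕ ⊕ ℕ → Bool) → β → Prop} (hS : Sig S) {L : α → List ℕ}
    (hL : Primrec L) {j : ℕ → ι} (hj : Primrec j) {t : α → β} (ht : Primrec t) :
    Sig (fun (A : ι → Bool) a => S (Sum.elim (lst (L a)) (fun k => A (j k))) (t a)) := by
  refine Sig.osubst (S := fun O a => S O (t a))
    (Φ := fun A a => Sum.elim (lst (L a)) (fun k => A (j k))) (hS.comp ht) ?_
  refine Sig.sumElim (f := fun A a => lst (L a)) (g := fun A _ k => A (j k)) (sig_lst hL) ?_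
  exact Sig.atom (hj.comp (Primrec.fst.comp Primrec.snd)) (Primrec.snd.comp Primrec.snd)

theorem exists_seq {C : Type*} (le : C → C → Prop) (hr : ∀ c, le c c)
    (ht : ∀ a b c, le a b → le b c → le a c) (D : ℕ → C → Prop)
    (h : ∀ e c, ∃ d, le d c ∧ D e d) (c0 : C) :
    ∃ s : ℕ → C, s 0 = c0 ∧ (∀ i j, i ≤ j → le (s j) (s i)) ∧ ∀ e, D e (s (e + 1)) := by
  choose nx h1 h2 using h
  let s : ℕ → C := fun n => Nat.rec c0 (fun e c => nx e c) n
  refine ⟨s, rfl, ?_, fun e => h2 e (s e)⟩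
  intro i j hij
  induction hij with
  | refl => exact hr _
  | step _ ih => exact ht _ _ _ (h1 _ _) ih

theorem basis {w : ℕ → Bool} {A : ι → Bool} (hA : Good w A) (N : (κ ⊕ ι → Bool) → Prop)
    (hN : Sig (fun O (_ : Unit) => N O)) (hex : ∃ g : κ → Bool, ¬ N (Sum.elim g A)) :
    ∃ g : κ → Bool, ¬ N (Sum.elim g A) ∧ Good w (Sum.elim g A) := by
  obtain ⟨e, he, hall⟩ := exists_enum_sig (ι := κ ⊕ ι) (α := ℕ × Bool)
  let C := {N : (κ ⊕ ι → Bool) → Prop // Sig (fun O (_ : Unit) => N O) ∧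
    ∃ g : κ → Bool, ¬ N (Sum.elim g A)}
  obtain ⟨s, h0, hdec, hD⟩ := exists_seq (C := C) (fun d c => ∀ O, c.1 O → d.1 O)
    (fun c O h => h) (fun a b c h1 h2 O h => h1 _ (h2 _ h))
    (fun i d => ∀ g : κ → Bool, ¬ d.1 (Sum.elim g A) →
      ¬ ∀ n b, e i (Sum.elim g A) (n, b) ↔ w n = b) (by
    rintro i ⟨M, hM, hMex⟩
    have hT : Sig (fun (A : ι → Bool) (a : ℕ × Bool) => ∀ g : κ → Bool,
        M (Sum.elim g A) ∨ e i (Sum.elim g A) a) :=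
      Sig.all (S := fun O a => M O ∨ e i O a)
        (Sig.or (hM.comp (f := fun _ : ℕ × Bool => ()) (Primrec.const ())) (he i))
    rcases hA.dich hT with ⟨n, b, hT, hne⟩ | ⟨n, hT⟩
    · refine ⟨⟨M, hM, hMex⟩, fun _ h => h, fun g hg hcon => ?_⟩
      exact hne ((hcon n b).1 ((hT g).resolve_left hg))
    · push Not at hT
      obtain ⟨g, hg1, hg2⟩ := hT
      refine ⟨⟨fun O => M O ∨ e i O (n, w n), ?_, g, ?_⟩, fun O h => Or.inl h, ?_⟩
      · exact hM.or ((he i).comp (f := fun _ : Unit => (n, w n)) (Primrec.const _))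
      · rw [not_or]; exact ⟨hg1, hg2⟩
      · intro g hg hcon
        exact hg (Or.inr ((hcon n (w n)).2 rfl))) ⟨N, hN, hex⟩
  choose g hg using fun i => (s i).2.2
  have key : ∀ i, ¬ (s i).1 (Sum.elim (ulim g) A) := by
    intro i hi
    obtain ⟨l, hl⟩ := (s i).2.1.use (a := ()) hi
    have h1 := ulim_spec_list g (l.filterMap Sum.getLeft?)
    obtain ⟨n, hn1, hn2⟩ := (h1.and (hyper_ge i)).exists
    refine hg n (hdec i n hn2 _ (hl _ ?_))
    rintro (k | k) hk
    · exact hn1 k (List.mem_filterMap.2 ⟨_, hk, rfl⟩)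
    · rfl
  refine ⟨ulim g, ?_, ?_⟩
  · have := key 0
    rw [h0] at this
    exact this
  · intro S hS hcon
    obtain ⟨i, rfl⟩ := hall S hS
    exact hD i _ (key (i + 1)) hcon

/-- infinite (boolean) sets -/
def Inf (X : ℕ → Bool) : Prop := ∀ m, ∃ x, m ≤ x ∧ X x = true

def cut (X : ℕ → Bool) (m : ℕ) : ℕ → Bool := fun x => X x && decide (m ≤ x)

theorem cut_iff {X : ℕ → Bool} {m x : ℕ} : cut X m x = true ↔ X x = true ∧ m ≤ x := by
  simp [cut]

theorem Inf.cut {X : ℕ → Bool} (h : Inf X) (m : ℕ) : Inf (cut X m) := by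
  intro k
  obtain ⟨x, hx, hX⟩ := h (k + m)
  exact ⟨x, by omega, cut_iff.2 ⟨hX, by omega⟩⟩

theorem Good.cut {w : ℕ → Bool} {X Z : ℕ → Bool} (h : Good w (Sum.elim X Z)) (m : ℕ) :
    Good w (Sum.elim (cut X m) Z) := by
  have := h.map (κ := ℕ ⊕ ℕ) (fun O => Sum.elim (fun x => O (Sum.inl x) && decide (m ≤ x))
    (fun k => O (Sum.inr k))) ?_
  · exact this
  · have h1 : Sig (fun (O : ℕ ⊕ ℕ → Bool) (p : Unit × (ℕ × Bool)) =>
        (O (Sum.inl p.2.1) && decide (m ≤ p.2.1)) = p.2.2) := by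
      have hm : PrimrecPred fun p : Unit × (ℕ × Bool) => m ≤ p.2.1 :=
        Primrec.nat_le.comp (Primrec.const m) (Primrec.fst.comp Primrec.snd)
      have hi : Primrec fun p : Unit × (ℕ × Bool) => (Sum.inl p.2.1 : ℕ ⊕ ℕ) :=
        Primrec.sumInl.comp (Primrec.fst.comp Primrec.snd)
      refine (Sig.or (Sig.and (Sig.prim hm) (Sig.atom hi (Primrec.snd.comp Primrec.snd)))
        (Sig.and (Sig.prim hm.not) (Sig.prim (Primrec.eq.comp (Primrec.snd.comp Primrec.snd)
          (Primrec.const false))))).of_eq ?_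
      rintro A ⟨_, x, b⟩
      by_cases hx : m ≤ x <;> simp [hx, eq_comm]
    have h2 : Sig (fun (O : ℕ ⊕ ℕ → Bool) (p : Unit × (ℕ × Bool)) =>
        O (Sum.inr p.2.1) = p.2.2) :=
      Sig.atom (Primrec.sumInr.comp (Primrec.fst.comp Primrec.snd))
        (Primrec.snd.comp Primrec.snd)
    exact (Sig.sumElim (f := fun (O : ℕ ⊕ ℕ → Bool) (_ : Unit) x =>
      (O (Sum.inl x) && decide (m ≤ x))) (g := fun O _ k => O (Sum.inr k)) h1 h2).comp
      (f := fun p => ((), p)) (Primrec.pair (Primrec.const ()) Primrec.id)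

theorem Good.inter {w : ℕ → Bool} {g X Z : ℕ → Bool} (h : Good w (Sum.elim g (Sum.elim X Z)))
    (i : Bool) : Good w (Sum.elim (fun x => X x && (g x == i)) Z) := by
  have := h.map (κ := ℕ ⊕ ℕ) (fun O => Sum.elim
    (fun x => O (Sum.inr (Sum.inl x)) && (O (Sum.inl x) == i))
    (fun k => O (Sum.inr (Sum.inr k)))) ?_
  · exact this
  · have h1 : Sig (fun (O : ℕ ⊕ (ℕ ⊕ ℕ) → Bool) (p : Unit × (ℕ × Bool)) =>
        (O (Sum.inr (Sum.inl p.2.1)) && (O (Sum.inl p.2.1) == i)) = p.2.2) := by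
      have hi : Primrec fun p : Unit × (ℕ × Bool) => (Sum.inl p.2.1 : ℕ ⊕ (ℕ ⊕ ℕ)) :=
        Primrec.sumInl.comp (Primrec.fst.comp Primrec.snd)
      have hj : Primrec fun p : Unit × (ℕ × Bool) => (Sum.inr (Sum.inl p.2.1) : ℕ ⊕ (ℕ ⊕ ℕ)) :=
        Primrec.sumInr.comp (Primrec.sumInl.comp (Primrec.fst.comp Primrec.snd))
      refine (Sig.or (Sig.and (Sig.atom hi (Primrec.const i))
          (Sig.atom hj (Primrec.snd.comp Primrec.snd)))
        (Sig.and (Sig.atom hi (Primrec.const (!i)))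
          (Sig.prim (Primrec.eq.comp (Primrec.snd.comp Primrec.snd)
          (Primrec.const false))))).of_eq ?_
      rintro A ⟨_, x, b⟩
      cases i <;> cases hx : A (Sum.inl x) <;> simp [eq_comm, hx]
    have h2 : Sig (fun (O : ℕ ⊕ (ℕ ⊕ ℕ) → Bool) (p : Unit × (ℕ × Bool)) =>
        O (Sum.inr (Sum.inr p.2.1)) = p.2.2) :=
      Sig.atom (Primrec.sumInr.comp (Primrec.sumInr.comp (Primrec.fst.comp Primrec.snd)))
        (Primrec.snd.comp Primrec.snd)
    exact (Sig.sumElim (f := fun (O : ℕ ⊕ (ℕ ⊕ ℕ) → Bool) (_ : Unit) x =>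
      (O (Sum.inr (Sum.inl x)) && (O (Sum.inl x) == i)))
      (g := fun O _ k => O (Sum.inr (Sum.inr k))) h1 h2).comp
      (f := fun p => ((), p)) (Primrec.pair (Primrec.const ()) Primrec.id)

end Cone
end RRT

namespace RRT

section RT1
open Encodable

/-- a bound above all entries of a list -/
theorem exists_bd (l : List ℕ) : ∃ m, ∀ x ∈ l, x < m := by
  induction l with
  | nil => exact ⟨0, by simp⟩
  | cons a l ih =>
    obtain ⟨m, hm⟩ := ih
    refine ⟨max m (a + 1), ?_⟩
    intro x hx
    rcases List.mem_cons.1 hx with rfl | hx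
    · omega
    · have := hm x hx; omega

/-- finite use of a `Sig` relation on the left part of the oracle -/
theorem use_left {α : Type} [Primcodable α] {S : (ℕ ⊕ ℕ → Bool) → α → Prop} (hS : Sig S)
    {G Z : ℕ → Bool} {a : α} (h : S (Sum.elim G Z) a) :
    ∃ m, ∀ G' : ℕ → Bool, (∀ x < m, G' x = G x) → S (Sum.elim G' Z) a := by
  obtain ⟨l, hl⟩ := hS.use h
  obtain ⟨m, hm⟩ := exists_bd (l.filterMap Sum.getLeft?)
  refine ⟨m, fun G' hG' => hl _ ?_⟩
  rintro (k | k) hk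
  · exact hG' k (hm k (List.mem_filterMap.2 ⟨_, hk, rfl⟩))
  · rfl

structure RC (w X Z B : ℕ → Bool) where
  F : Bool → List ℕ
  R : ℕ → Bool
  hF : ∀ i, ∀ x ∈ F i, X x = true ∧ B x = i
  hR : ∀ x, R x = true → X x = true
  inf : Inf R
  good : Good w (Sum.elim R Z)
  lt : ∀ i, ∀ x ∈ F i, ∀ y, R y = true → x < y

variable {w X Z B : ℕ → Bool}

def RC.le (d c : RC w X Z B) : Prop :=
  (∀ i, ∀ x ∈ c.F i, x ∈ d.F i) ∧ (∀ i, ∀ x ∈ d.F i, x ∈ c.F i ∨ c.R x = true) ∧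
    (∀ x, d.R x = true → c.R x = true)

theorem RC.le_refl (c : RC w X Z B) : c.le c :=
  ⟨fun _ _ h => h, fun _ _ h => Or.inl h, fun _ h => h⟩

theorem RC.le_trans (a b c : RC w X Z B) (h1 : a.le b) (h2 : b.le c) : a.le c := by
  refine ⟨fun i x h => h1.1 i x (h2.1 i x h), fun i x h => ?_, fun x h => h2.2.2 x (h1.2.2 x h)⟩
  rcases h1.2.1 i x h with h | h
  · exact h2.2.1 i x h
  · exact Or.inr (h2.2.2 x h)

def RC.compat (c : RC w X Z B) (i : Bool) (G : ℕ → Bool) : Prop :=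
  (∀ x ∈ c.F i, G x = true) ∧ ∀ x, G x = true → x ∈ c.F i ∨ c.R x = true

/-- extend side `i` by a finite list from the reservoir, and cut. -/
theorem RC.extend (c : RC w X Z B) (i : Bool) (E : List ℕ)
    (hE : ∀ x ∈ E, c.R x = true ∧ B x = i) (m : ℕ) :
    ∃ d : RC w X Z B, d.le c ∧ d.F i = c.F i ++ E ∧ ∀ x, d.R x = true → m ≤ x := by
  obtain ⟨m', hm'⟩ := exists_bd E
  let F' : Bool → List ℕ := fun j => if j = i then c.F i ++ E else c.F j
  have hF' : ∀ j, ∀ x ∈ F' j, x ∈ c.F j ∨ (j = i ∧ x ∈ E) := by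
    intro j x hx
    by_cases hj : j = i
    · subst hj
      simpa [F'] using hx
    · simp only [F', hj, if_false] at hx
      exact Or.inl hx
  refine ⟨⟨F', cut c.R (max m m'), ?_, ?_, c.inf.cut _, c.good.cut _, ?_⟩, ⟨?_, ?_, ?_⟩, ?_, ?_⟩
  · intro j x hx
    rcases hF' j x hx with h | ⟨rfl, h⟩
    · exact c.hF j x h
    · exact ⟨c.hR x (hE x h).1, (hE x h).2⟩
  · intro x hx
    exact c.hR x (cut_iff.1 hx).1
  · intro j x hx y hy
    have hy := cut_iff.1 hy
    rcases hF' j x hx with h | ⟨rfl, h⟩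
    · exact c.lt j x h y hy.1
    · have := hm' x h
      have := hy.2
      omega
  · intro j x hx
    show x ∈ F' j
    by_cases hj : j = i
    · subst hj; simp [F', hx]
    · simp [F', hj, hx]
  · intro j x hx
    rcases hF' j x hx with h | ⟨rfl, h⟩
    · exact Or.inl h
    · exact Or.inr (hE x h).1
  · intro x hx
    exact (cut_iff.1 hx).1
  · simp [F']
  · intro x hx
    have := (cut_iff.1 hx).2
    omega

theorem RC.grow (hno : ¬ ∃ Y, Inf Y ∧ Good w (Sum.elim Y Z) ∧ (∀ x, Y x = true → X x = true) ∧
      ∃ i, ∀ x, Y x = true → B x = i) (c : RC w X Z B) (i : Bool) (m : ℕ) :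
    ∃ d : RC w X Z B, d.le c ∧ ∃ x ∈ d.F i, m ≤ x := by
  have : ∃ x, c.R x = true ∧ B x = i ∧ m ≤ x := by
    by_contra hcon
    push Not at hcon
    refine hno ⟨cut c.R m, c.inf.cut m, c.good.cut m, fun x hx => c.hR x (cut_iff.1 hx).1, !i, ?_⟩
    intro x hx
    have hx := cut_iff.1 hx
    by_contra hne
    have : B x = i := by
      cases i <;> cases hB : B x <;> simp_all
    have := hcon x hx.1 this
    omega
  obtain ⟨x, hx1, hx2, hx3⟩ := this
  obtain ⟨d, hd, hF, -⟩ := c.extend i [x] (by simp [hx1, hx2]) 0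
  exact ⟨d, hd, x, by simp [hF], hx3⟩

theorem RC.force (c : RC w X Z B) (S : Bool → (ℕ ⊕ ℕ → Bool) → ℕ × Bool → Prop)
    (hS : ∀ i, Sig (S i)) : ∃ d : RC w X Z B, d.le c ∧ ∃ i, ∀ G, d.compat i G →
      ¬ ∀ n b, S i (Sum.elim G Z) (n, b) ↔ w n = b := by
  let T : Bool → (ℕ ⊕ (ℕ ⊕ ℕ) → Bool) → ℕ × Bool → Prop := fun i O a =>
    ∃ E : List ℕ, (∀ x ∈ E, O (Sum.inr (Sum.inl x)) = true ∧ O (Sum.inl x) = i) ∧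
      S i (Sum.elim (lst (c.F i ++ E)) (fun k => O (Sum.inr (Sum.inr k)))) a
  have hT : ∀ i, Sig (T i) := by
    intro i
    refine Sig.ex (Sig.and (Sig.forall_mem Primrec.snd (Sig.and (Sig.atom ?_ ?_) 
      (Sig.atom ?_ ?_))) (sig_fin (hS i) (L := fun p : (ℕ × Bool) × List ℕ => c.F i ++ p.2) 
        ?_ ?_ Primrec.fst))
    · exact Primrec.sumInr.comp (Primrec.sumInl.comp Primrec.snd)
    · exact Primrec.const true
    · exact Primrec.sumInl.comp Primrec.snd
    · exact Primrec.const i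
    · exact Primrec.list_append.comp (Primrec.const _) Primrec.snd
    · exact Primrec.sumInr.comp Primrec.sumInr
  have hT' : Sig (fun (A : ℕ ⊕ ℕ → Bool) (a : ℕ × Bool) => ∀ g : ℕ → Bool,
      T true (Sum.elim g A) a ∨ T false (Sum.elim g A) a) :=
    Sig.all (S := fun O a => T true O a ∨ T false O a) ((hT true).or (hT false))
  rcases c.good.dich hT' with ⟨n, b, hP, hne⟩ | ⟨n, hNg⟩
  · have : ∃ i, T i (Sum.elim B (Sum.elim c.R Z)) (n, b) := by
      rcases hP B with h | h
      · exact ⟨_, h⟩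
      · exact ⟨_, h⟩
    obtain ⟨i, E, hE, hSE⟩ := this
    obtain ⟨m, hm⟩ := use_left (hS i) hSE
    obtain ⟨d, hd, hF, hdm⟩ := c.extend i E hE m
    refine ⟨d, hd, i, fun G hG hcon => hne ((hcon n b).1 (hm G ?_))⟩
    intro x hx
    rw [Bool.eq_iff_iff, lst_iff, ← hF]
    constructor
    · intro h
      rcases hG.2 x h with h | h
      · exact h
      · have := hdm x h; omega
    · exact hG.1 x
  · obtain ⟨g, hg, hgood⟩ := basis c.good (κ := ℕ) (fun O => T true O (n, w n) ∨ T false O (n, w n))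
      ((Sig.or (hT true) (hT false)).comp (f := fun _ : Unit => (n, w n)) (Primrec.const _)) 
      (by by_contra hcon; push Not at hcon; exact hNg fun g => hcon g)
    have hinf : ∃ i, Inf (fun x => c.R x && (g x == i)) := by
      by_contra hcon
      push Not at hcon
      have h1 := hcon true
      have h2 := hcon false
      unfold Inf at h1 h2
      push Not at h1 h2
      obtain ⟨m1, h1⟩ := h1
      obtain ⟨m2, h2⟩ := h2
      obtain ⟨x, hx, hxR⟩ := c.inf (m1 + m2)
      have h1 := h1 x (by omega)
      have h2 := h2 x (by omega)
      cases hgx : g x <;> simp [hgx, hxR] at h1 h2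
    obtain ⟨i, hi⟩ := hinf
    have hgT : ¬ T i (Sum.elim g (Sum.elim c.R Z)) (n, w n) := by
      rw [not_or] at hg
      cases i
      · exact hg.2
      · exact hg.1
    refine ⟨⟨c.F, fun x => c.R x && (g x == i), c.hF, fun x hx => c.hR x ?_, hi,
      hgood.inter i, fun j x hx y hy => c.lt j x hx y ?_⟩, ⟨fun _ _ h => h, fun _ _ h => Or.inl h,
        fun x hx => ?_⟩, i, ?_⟩
    · simp only [Bool.and_eq_true] at hx; exact hx.1
    · simp only [Bool.and_eq_true] at hy; exact hy.1
    · simp only [Bool.and_eq_true] at hx; exact hx.1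
    · intro G hG hcon
      have hSG := (hcon n (w n)).2 rfl
      obtain ⟨m, hm⟩ := use_left (hS i) hSG
      refine hgT ⟨(List.range m).filter (fun x => G x && (c.R x && (g x == i))), ?_, hm _ ?_⟩
      · intro x hx
        simp only [List.mem_filter, Bool.and_eq_true, beq_iff_eq] at hx
        exact ⟨hx.2.2.1, hx.2.2.2⟩
      · intro x hx
        rw [Bool.eq_iff_iff, lst_iff, List.mem_append]
        constructor
        · rintro (h | h)
          · exact hG.1 x h
          · simp only [List.mem_filter, Bool.and_eq_true, beq_iff_eq] at h
            exact h.2.1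
        · intro h
          rcases hG.2 x h with h' | h'
          · exact Or.inl h'
          · right
            have h' : (c.R x && (g x == i)) = true := h'
            simp only [List.mem_filter, List.mem_range]
            exact ⟨hx, by rw [h, h']; rfl⟩

/-- Strong cone avoidance for the pigeonhole principle. -/
theorem rt1 (hX : Inf X) (hG : Good w (Sum.elim X Z)) (B : ℕ → Bool) :
    ∃ Y, Inf Y ∧ Good w (Sum.elim Y Z) ∧ (∀ x, Y x = true → X x = true) ∧
      ∃ i, ∀ x, Y x = true → B x = i := by
  classical
  by_contra hno
  obtain ⟨e, he, hall⟩ := exists_enum_sig (ι := ℕ ⊕ ℕ) (α := ℕ × Bool)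
  obtain ⟨s, h0, hdec, hD⟩ := exists_seq (C := RC w X Z B) RC.le RC.le_refl RC.le_trans
    (fun k d => (∀ i, ∃ x ∈ d.F i, k ≤ x) ∧ ∃ i : Bool, ∀ G, d.compat i G →
      ¬ ∀ n b, e (if i then k.unpair.1 else k.unpair.2) (Sum.elim G Z) (n, b) ↔ w n = b) (by
    intro k c
    obtain ⟨d1, h1, x1, hx1, hk1⟩ := c.grow hno true k
    obtain ⟨d2, h2, x2, hx2, hk2⟩ := d1.grow hno false k
    obtain ⟨d3, h3, i, h4⟩ := d2.force (fun i => e (if i then k.unpair.1 else k.unpair.2))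
      (fun i => he _)
    refine ⟨d3, RC.le_trans _ _ _ (RC.le_trans _ _ _ h3 h2) h1, ?_, i, h4⟩
    intro j
    cases j
    · exact ⟨x2, h3.1 _ _ hx2, hk2⟩
    · exact ⟨x1, h3.1 _ _ (h2.1 _ _ hx1), hk1⟩) ⟨fun _ => [], X, by simp, fun _ h => h, hX, hG,
        by simp⟩
  let G : Bool → ℕ → Bool := fun i x => decide (∃ k, x ∈ (s k).F i)
  have hGi : ∀ i x, G i x = true ↔ ∃ k, x ∈ (s k).F i := by intro i x; simp [G]
  have hcompat : ∀ i k, (s k).compat i (G i) := by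
    intro i k
    refine ⟨fun x hx => (hGi i x).2 ⟨k, hx⟩, fun x hx => ?_⟩
    obtain ⟨j, hj⟩ := (hGi i x).1 hx
    rcases le_total j k with h | h
    · exact Or.inl ((hdec j k h).1 i x hj)
    · exact (hdec k j h).2.1 i x hj
  have hInf : ∀ i, Inf (G i) := by
    intro i m
    obtain ⟨x, hx, hm⟩ := (hD m).1 i
    exact ⟨x, hm, (hGi i x).2 ⟨_, hx⟩⟩
  have hbad : ∀ i, ¬ Good w (Sum.elim (G i) Z) := by
    intro i hi
    refine hno ⟨G i, hInf i, hi, ?_, i, ?_⟩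
    · intro x hx
      obtain ⟨j, hj⟩ := (hGi i x).1 hx
      exact ((s j).hF i x hj).1
    · intro x hx
      obtain ⟨j, hj⟩ := (hGi i x).1 hx
      exact ((s j).hF i x hj).2
  have h1 : ∀ i, ∃ k, ∀ n b, e k (Sum.elim (G i) Z) (n, b) ↔ w n = b := by
    intro i
    have := hbad i
    unfold Good at this
    push Not at this
    obtain ⟨S, hS, h⟩ := this
    obtain ⟨k, rfl⟩ := hall S hS
    exact ⟨k, h⟩
  obtain ⟨k1, hk1⟩ := h1 true
  obtain ⟨k2, hk2⟩ := h1 false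
  obtain ⟨i, hi⟩ := (hD (Nat.pair k1 k2)).2
  refine hi (G i) (hcompat i _) ?_
  cases i
  · simpa using hk2
  · simpa using hk1

theorem rt1_list (N : ℕ) : ∀ (X : ℕ → Bool), Inf X → Good w (Sum.elim X Z) →
    ∀ P : ℕ → ℕ → Prop, (∀ x, X x = true → ∃ i < N, P i x) →
    ∃ i, ∃ Y, Inf Y ∧ Good w (Sum.elim Y Z) ∧ (∀ x, Y x = true → X x = true) ∧
      ∀ x, Y x = true → P i x := by
  classical
  induction N with
  | zero =>
    intro X hX _ P hP
    obtain ⟨x, -, hx⟩ := hX 0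
    obtain ⟨i, hi, -⟩ := hP x hx
    omega
  | succ N ih =>
    intro X hX hG P hP
    obtain ⟨Y, hY, hYG, hYX, i, hi⟩ := rt1 hX hG (fun x => decide (P N x))
    cases i
    · obtain ⟨j, Y', h1, h2, h3, h4⟩ := ih Y hY hYG P (by
        intro x hx
        obtain ⟨j, hj, hPj⟩ := hP x (hYX x hx)
        refine ⟨j, ?_, hPj⟩
        have := hi x hx
        have hne : j ≠ N := by
          rintro rfl
          simp [hPj] at this
        omega)
      exact ⟨j, Y', h1, h2, fun x hx => hYX x (h3 x hx), h4⟩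
    · exact ⟨N, Y, hY, hYG, hYX, fun x hx => by simpa using hi x hx⟩

end RT1
end RRT

namespace RRT

section Rainbow
open Encodable

abbrev Cst := (ℕ × ℕ) × (ℕ × ℕ) → Bool

/-- `G` is independent with respect to the constraint `R`. -/
def Indep (R : Cst) (G : ℕ → Prop) : Prop :=
  ∀ a b c d, G a → G b → G c → G d → a < b → c < d → (a, b) ≠ (c, d) →
    R ((a, b), (c, d)) = false

theorem Indep.mono {R R' : Cst} {G G' : ℕ → Prop} (h : Indep R G)
    (hR : ∀ p, R' p = true → R p = true) (hG : ∀ x, G' x → G x) : Indep R' G' := by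
  intro a b c d ha hb hc hd h1 h2 h3
  have := h a b c d (hG _ ha) (hG _ hb) (hG _ hc) (hG _ hd) h1 h2 h3
  by_contra hne
  have h4 := hR _ (by simpa using hne)
  rw [this] at h4
  exact absurd h4 (by simp)

def Deg (R : Cst) (k : ℕ) : Prop :=
  ∀ p : ℕ × ℕ, ∀ L : List (ℕ × ℕ), L.Nodup → (∀ q ∈ L, R (p, q) = true) → L.length ≤ k

def Cls (k : ℕ) (F : List ℕ) (X : ℕ → Bool) (g : Cst) : Prop :=
  (∀ p q, g (p, q) = true → g (q, p) = true) ∧ Deg g k ∧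
    ∀ x, X x = true → Indep g (fun z => z ∈ F ++ [x])

theorem Deg.bd {R : Cst} {k : ℕ} (h : Deg R k) (p : ℕ × ℕ) :
    ∃ m, ∀ q, R (p, q) = true → q.2 < m := by
  have hfin : {q | R (p, q) = true}.Finite := by
    by_contra hinf
    obtain ⟨t, ht, hc⟩ := Set.Infinite.exists_subset_card_eq hinf (k + 1)
    have := h p t.toList t.nodup_toList (fun q hq => ht (by simpa using hq))
    rw [Finset.length_toList, hc] at this
    omega
  obtain ⟨m, hm⟩ := exists_bd (hfin.toFinset.toList.map Prod.snd)
  refine ⟨m, fun q hq => hm _ (List.mem_map.2 ⟨q, ?_, rfl⟩)⟩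
  simpa using hq

theorem Deg.bd_list {R : Cst} {k : ℕ} (h : Deg R k) (L : List ℕ) :
    ∃ m, ∀ a ∈ L, ∀ b ∈ L, ∀ q, R ((a, b), q) = true → q.2 < m := by
  choose f hf using fun p => h.bd p
  obtain ⟨m, hm⟩ := exists_bd ((L ×ˢ L).map f)
  refine ⟨m, fun a ha b hb q hq => ?_⟩
  have h1 := hf _ _ hq
  have h2 := hm (f (a, b)) (List.mem_map.2 ⟨(a, b), by simp [ha, hb], rfl⟩)
  omega

theorem ulim_list {ι : Type} (g : ℕ → ι → Bool) (l : List ι) (N : ℕ) :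
    ∃ n, N ≤ n ∧ ∀ i ∈ l, g n i = ulim g i := by
  obtain ⟨n, h1, h2⟩ := ((ulim_spec_list g l).and (hyper_ge N)).exists
  exact ⟨n, h2, h1⟩

theorem cls_ulim {k : ℕ} {F : List ℕ} {X : ℕ → Bool} {g : ℕ → Cst}
    (h : ∀ n, Cls k F X (g n)) : Cls k F X (ulim g) := by
  refine ⟨?_, ?_, ?_⟩
  · intro p q hpq
    obtain ⟨n, -, hn⟩ := ulim_list g [(p, q), (q, p)] 0
    rw [← hn _ (by simp)] at hpq ⊢
    exact (h n).1 _ _ hpq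
  · intro p L hL hR
    obtain ⟨n, -, hn⟩ := ulim_list g (L.map fun q => (p, q)) 0
    refine (h n).2.1 p L hL fun q hq => ?_
    rw [hn _ (List.mem_map.2 ⟨q, hq, rfl⟩)]
    exact hR q hq
  · intro x hx a b c d ha hb hc hd h1 h2 h3
    obtain ⟨n, -, hn⟩ := ulim_list g [((a, b), (c, d))] 0
    rw [← hn _ (by simp)]
    exact (h n).2.2 x hx a b c d ha hb hc hd h1 h2 h3

structure QC (w Z : ℕ → Bool) where
  F : List ℕ
  R : Cst
  k : ℕ
  X : ℕ → Bool
  cls : Cls k F X R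
  inf : Inf X
  good : Good w (Sum.elim X Z)
  lt : ∀ x ∈ F, ∀ y, X y = true → x < y

variable {w Z : ℕ → Bool}

def Rx (R : Cst) (x : ℕ) : Cst := fun p =>
  R p || (decide (p.1.2 = p.2.2) && R ((p.1.1, x), (p.2.1, x)))

theorem Rx_iff {R : Cst} {x : ℕ} {p : (ℕ × ℕ) × (ℕ × ℕ)} : Rx R x p = true ↔
    R p = true ∨ (p.1.2 = p.2.2 ∧ R ((p.1.1, x), (p.2.1, x)) = true) := by
  simp [Rx]

theorem QC.cls_Rx (c : QC w Z) {x : ℕ} (hx : c.X x = true) :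
    Cls (2 * c.k) c.F c.X (Rx c.R x) := by
  obtain ⟨h1, h2, h3⟩ := c.cls
  refine ⟨?_, ?_, ?_⟩
  · intro p q hpq
    rw [Rx_iff] at hpq ⊢
    rcases hpq with h | ⟨h, h'⟩
    · exact Or.inl (h1 _ _ h)
    · exact Or.inr ⟨h.symm, h1 _ _ h'⟩
  · intro p L hL hR
    have hlen := List.length_eq_length_filter_add (l := L) (fun q => c.R (p, q))
    have ha : (L.filter (fun q => c.R (p, q))).length ≤ c.k := by
      refine h2 p _ (hL.filter _) ?_
      intro q hq
      exact (List.mem_filter.1 hq).2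
    have hprop : ∀ q ∈ L.filter (fun q => !c.R (p, q)),
        p.2 = q.2 ∧ c.R ((p.1, x), (q.1, x)) = true := by
      intro q hq
      obtain ⟨hq1, hq2⟩ := List.mem_filter.1 hq
      rcases Rx_iff.1 (hR q hq1) with h | h
      · simp [h] at hq2
      · exact h
    have hb : (L.filter (fun q => !c.R (p, q))).length ≤ c.k := by
      have := h2 (p.1, x) ((L.filter (fun q => !c.R (p, q))).map fun q => (q.1, x)) ?_ ?_
      · simpa using this
      · refine List.Nodup.map_on ?_ (hL.filter _)
        intro q hq r hr he
        have e1 := (hprop q hq).1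
        have e2 := (hprop r hr).1
        have e3 : q.1 = r.1 := (Prod.mk.inj he).1
        exact Prod.ext e3 (e1.symm.trans e2)
      · intro q hq
        obtain ⟨r, hr, rfl⟩ := List.mem_map.1 hq
        exact (hprop r hr).2
    omega
  · intro x' hx' a b e d ha hb he hd hab hed hne
    rw [Bool.eq_false_iff, Ne, Rx_iff]
    rintro (h | ⟨h, h'⟩)
    · rw [h3 x' hx' a b e d ha hb he hd hab hed hne] at h
      exact absurd h (by simp)
    · have hmem : ∀ u v, u ∈ c.F ++ [x'] → v ∈ c.F ++ [x'] → u < v → u ∈ c.F := by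
        intro u v hu hv huv
        simp only [List.mem_append, List.mem_singleton] at hu hv
        rcases hu with hu | rfl
        · exact hu
        · rcases hv with hv | rfl
          · have := c.lt v hv _ hx'
            omega
          · omega
      have haF := hmem a b ha hb hab
      have heF := hmem e d he hd hed
      rw [h3 x hx a x e x (by simp [haF]) (by simp) (by simp [heF]) (by simp)
        (c.lt a haF x hx) (c.lt e heF x hx) ?_] at h'
      · exact absurd h' (by simp)
      · intro heq
        have : a = e := (Prod.mk.inj heq).1
        exact hne (Prod.ext this h)

def QC.le (d c : QC w Z) : Prop :=
  (∀ x ∈ c.F, x ∈ d.F) ∧ (∀ x ∈ d.F, x ∈ c.F ∨ c.X x = true) ∧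
    (∀ x, d.X x = true → c.X x = true) ∧ ∀ p, c.R p = true → d.R p = true

theorem QC.le_refl (c : QC w Z) : c.le c :=
  ⟨fun _ h => h, fun _ h => Or.inl h, fun _ h => h, fun _ h => h⟩

theorem QC.le_trans (a b c : QC w Z) (h1 : a.le b) (h2 : b.le c) : a.le c := by
  refine ⟨fun x h => h1.1 x (h2.1 x h), fun x h => ?_, fun x h => h2.2.2.1 x (h1.2.2.1 x h),
    fun p h => h1.2.2.2 p (h2.2.2.2 p h)⟩
  rcases h1.2.1 x h with h | h
  · exact h2.2.1 x h
  · exact Or.inr (h2.2.2.1 x h)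

def QC.cut (c : QC w Z) (m : ℕ) : QC w Z where
  F := c.F
  R := c.R
  k := c.k
  X := RRT.cut c.X m
  cls := ⟨c.cls.1, c.cls.2.1, fun x hx => c.cls.2.2 x (cut_iff.1 hx).1⟩
  inf := c.inf.cut m
  good := c.good.cut m
  lt := fun x hx y hy => c.lt x hx y (cut_iff.1 hy).1

theorem QC.cut_le (c : QC w Z) (m : ℕ) : (c.cut m).le c :=
  ⟨fun _ h => h, fun _ h => Or.inl h, fun _ h => (cut_iff.1 h).1, fun _ h => h⟩

/-- Extension property used in the positive case. -/
def Ext (F : List ℕ) (X : ℕ → Bool) (g : Cst) (E : List ℕ) (y : ℕ) : Prop :=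
  (∀ x ∈ E, X x = true ∧ x < y) ∧ X y = true ∧ Indep g (fun z => z ∈ F ++ E ++ [y])

theorem QC.extend (c : QC w Z) (Ψ : List ℕ → Prop)
    (H : ∀ g, Cls (2 * c.k) c.F c.X g → ∃ E y, Ext c.F c.X g E y ∧ Ψ E) (m : ℕ) :
    ∃ d : QC w Z, d.le c ∧ ∃ E, d.F = c.F ++ E ∧ Ψ E ∧ ∀ x, d.X x = true → m ≤ x := by
  have hN : ∃ N, ∀ x, c.X x = true → ∃ i < N, ∃ E y, encode (E, y) = i ∧
      Ext c.F c.X (Rx c.R x) E y ∧ Ψ E := by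
    by_contra hcon
    push Not at hcon
    choose x hx hbad using hcon
    obtain ⟨E, y, ⟨hE, hy, hI⟩, hΨ⟩ := H (ulim fun n => Rx c.R (x n))
      (cls_ulim fun n => c.cls_Rx (hx n))
    let L := c.F ++ E ++ [y]
    obtain ⟨n, hn1, hn2⟩ := ulim_list (fun n => Rx c.R (x n)) ((L ×ˢ L) ×ˢ (L ×ˢ L))
      (encode (E, y) + 1)
    refine hbad n (encode (E, y)) (by omega) E y rfl ⟨hE, hy, ?_⟩ hΨ
    intro a b e d ha hb he hd h1 h2 h3
    have hmem : ((a, b), (e, d)) ∈ (L ×ˢ L) ×ˢ (L ×ˢ L) := by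
      simp only [List.mem_product]
      exact ⟨⟨ha, hb⟩, he, hd⟩
    rw [hn2 _ hmem]
    exact hI a b e d ha hb he hd h1 h2 h3
  obtain ⟨N, hN⟩ := hN
  obtain ⟨i, Y, hY, hYG, hYX, hYP⟩ := rt1_list N c.X c.inf c.good _ hN
  obtain ⟨x0, -, hx0⟩ := hY 0
  obtain ⟨E, y, hi, ⟨hE, hy, -⟩, hΨ⟩ := hYP x0 hx0
  have hYP' : ∀ x, Y x = true → Indep (Rx c.R x) (fun z => z ∈ c.F ++ E ++ [y]) := by
    intro x hx
    obtain ⟨E', y', hi', ⟨-, -, hI⟩, -⟩ := hYP x hx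
    have := encode_injective (hi'.trans hi.symm)
    obtain ⟨rfl, rfl⟩ := Prod.mk.inj this
    exact hI
  obtain ⟨m1, hm1⟩ := c.cls.2.1.bd_list (c.F ++ E)
  obtain ⟨m2, hm2⟩ := exists_bd (c.F ++ E)
  have hlty : ∀ z ∈ c.F ++ E, z < y := by
    intro z hz
    rcases List.mem_append.1 hz with hz | hz
    · exact c.lt z hz y hy
    · exact (hE z hz).2
  refine ⟨⟨c.F ++ E, c.R, c.k, RRT.cut Y (m + m1 + m2), ⟨c.cls.1, c.cls.2.1, ?_⟩, hY.cut _,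
    hYG.cut _, ?_⟩, ⟨?_, ?_, ?_, ?_⟩, E, rfl, hΨ, ?_⟩
  · intro x hx a b e d ha hb he hd hab hed hne
    obtain ⟨hxY, hxm⟩ := cut_iff.1 hx
    have hI := hYP' x hxY
    have hsmall : ∀ u v, u ∈ c.F ++ E ++ [x] → v ∈ c.F ++ E ++ [x] → u < v →
        u ∈ c.F ++ E ∧ (v ∈ c.F ++ E ∨ v = x) := by
      intro u v hu hv huv
      rw [List.mem_append, List.mem_singleton] at hu hv
      refine ⟨?_, hv⟩
      rcases hu with hu | rfl
      · exact hu
      · rcases hv with hv | rfl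
        · have := hm2 v hv; omega
        · omega
    obtain ⟨haL, hbL⟩ := hsmall a b ha hb hab
    obtain ⟨heL, hdL⟩ := hsmall e d he hd hed
    have hm : ∀ z, z ∈ c.F ++ E → z ∈ c.F ++ E ++ [y] := fun z hz => List.mem_append_left _ hz
    have hym : y ∈ c.F ++ E ++ [y] := by simp
    rw [Bool.eq_false_iff]
    intro hR
    rcases hbL with hbL | rfl
    · rcases hdL with hdL | rfl
      · have := hI a b e d (hm _ haL) (hm _ hbL) (hm _ heL) (hm _ hdL) hab hed hne
        rw [Bool.eq_false_iff, Ne, Rx_iff] at this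
        exact this (Or.inl hR)
      · have := hm1 a haL b hbL _ hR
        simp only at this
        omega
    · rcases hdL with hdL | rfl
      · have := hm1 e heL d hdL _ (c.cls.1 _ _ hR)
        simp only at this
        omega
      · have hae : a ≠ e := by
          rintro rfl
          exact hne rfl
        have := hI a y e y (hm _ haL) hym (hm _ heL) hym (hlty _ haL) (hlty _ heL)
          (fun h => hae (Prod.mk.inj h).1)
        rw [Bool.eq_false_iff, Ne, Rx_iff] at this
        exact this (Or.inr ⟨rfl, hR⟩)
  · intro z hz x hx
    have := (cut_iff.1 hx).2
    have := hm2 z hz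
    omega
  · intro z hz
    exact List.mem_append_left _ hz
  · intro z hz
    rcases List.mem_append.1 hz with hz | hz
    · exact Or.inl hz
    · exact Or.inr (hE z hz).1
  · intro z hz
    exact hYX z (cut_iff.1 hz).1
  · exact fun _ h => h
  · intro x hx
    have := (cut_iff.1 hx).2
    omega

end Rainbow
end RRT

namespace RRT

section Final
open Encodable

variable {w Z : ℕ → Bool}

theorem Inf.many {X : ℕ → Bool} (h : Inf X) (r : ℕ) :
    ∃ t : Finset ℕ, t.card = r ∧ ∀ x ∈ t, X x = true := by
  have hinf : {x | X x = true}.Infinite := by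
    refine Set.infinite_of_forall_exists_gt fun m => ?_
    obtain ⟨x, hx, hX⟩ := h (m + 1)
    exact ⟨x, hX, by omega⟩
  obtain ⟨t, ht, hc⟩ := hinf.exists_subset_card_eq r
  exact ⟨t, hc, fun x hx => ht hx⟩

theorem QC.grow0 (c : QC w Z) (g : Cst) (hg : Cls (2 * c.k) c.F c.X g) :
    ∃ E y, Ext c.F c.X g E y ∧ E ≠ [] := by
  classical
  obtain ⟨t, ht, htX⟩ := c.inf.many (c.F.toFinset.card * (2 * c.k) + 1)
  obtain ⟨m1, hm1⟩ := hg.2.1.bd_list (c.F ++ t.toList)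
  obtain ⟨m2, hm2⟩ := exists_bd (c.F ++ t.toList)
  obtain ⟨y, hy, hyX⟩ := c.inf (m1 + m2)
  have hgood : ∃ e ∈ t, ∀ a ∈ c.F, g ((a, y), (e, y)) = false := by
    by_contra hcon
    push Not at hcon
    have hsub : t ⊆ c.F.toFinset.biUnion
        (fun a => t.filter (fun e => g ((a, y), (e, y)) = true)) := by
      intro e he
      obtain ⟨a, ha, hga⟩ := hcon e he
      simp only [Finset.mem_biUnion, List.mem_toFinset, Finset.mem_filter]
      exact ⟨a, ha, he, by simpa using hga⟩
    have h1 := Finset.card_le_card hsub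
    have h2 := Finset.card_biUnion_le_card_mul c.F.toFinset
      (fun a => t.filter (fun e => g ((a, y), (e, y)) = true)) (2 * c.k) (by
      intro a _
      have := hg.2.1 (a, y)
        ((t.filter (fun e => g ((a, y), (e, y)) = true)).toList.map fun e => (e, y)) ?_ ?_
      · simpa using this
      · refine List.Nodup.map_on ?_ (Finset.nodup_toList _)
        intro u _ v _ huv
        exact (Prod.mk.inj huv).1
      · intro q hq
        obtain ⟨e, he, rfl⟩ := List.mem_map.1 hq
        rw [Finset.mem_toList, Finset.mem_filter] at he
        exact he.2)
    omega
  obtain ⟨e, het, he⟩ := hgood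
  have heX := htX e het
  have heL : e ∈ c.F ++ t.toList := by simp [het]
  have hey : e < y := by
    have := hm2 e heL
    omega
  refine ⟨[e], y, ⟨by simp [heX, hey], hyX, ?_⟩, by simp⟩
  intro a b a' b' ha hb ha' hb' hab hab' hne
  have hsmall : ∀ u v, u ∈ c.F ++ [e] ++ [y] → v ∈ c.F ++ [e] ++ [y] → u < v →
      u ∈ c.F ++ [e] ∧ (v ∈ c.F ++ [e] ∨ v = y) := by
    intro u v hu hv huv
    rw [List.mem_append, List.mem_singleton] at hu hv
    refine ⟨?_, hv⟩
    rcases hu with hu | rfl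
    · exact hu
    · rcases hv with hv | rfl
      · have : v < u := by
          rcases List.mem_append.1 hv with hv | hv
          · exact c.lt v hv _ hyX
          · rw [List.mem_singleton] at hv
            omega
        omega
      · omega
  have hsub : ∀ z ∈ c.F ++ [e], z ∈ c.F ++ t.toList := by
    intro z hz
    simp only [List.mem_append, List.mem_singleton] at hz
    rcases hz with hz | rfl
    · exact List.mem_append_left _ hz
    · exact heL
  obtain ⟨haL, hbL⟩ := hsmall a b ha hb hab
  obtain ⟨haL', hbL'⟩ := hsmall a' b' ha' hb' hab'
  rcases hbL with hbL | rfl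
  · rcases hbL' with hbL' | rfl
    · exact hg.2.2 e heX a b a' b' haL hbL haL' hbL' hab hab' hne
    · rw [Bool.eq_false_iff]
      intro hR
      have := hm1 a (hsub _ haL) b (hsub _ hbL) _ hR
      simp only at this
      omega
  · rcases hbL' with hbL' | rfl
    · rw [Bool.eq_false_iff]
      intro hR
      have := hm1 a' (hsub _ haL') b' (hsub _ hbL') _ (hg.1 _ _ hR)
      simp only at this
      omega
    · have hae : a ≠ a' := by
        rintro rfl
        exact hne rfl
      rw [List.mem_append, List.mem_singleton] at haL haL'
      rcases haL with haL | rfl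
      · rcases haL' with haL' | rfl
        · exact hg.2.2 _ hyX a _ a' _ (by simp [haL]) (by simp) (by simp [haL']) (by simp)
            hab hab' hne
        · exact he a haL
      · rcases haL' with haL' | rfl
        · rw [Bool.eq_false_iff]
          intro hR
          have h1 := hg.1 _ _ hR
          rw [he a' haL'] at h1
          exact absurd h1 (by simp)
        · exact absurd rfl hae

theorem QC.grow (c : QC w Z) (m : ℕ) : ∃ d : QC w Z, d.le c ∧ ∃ x ∈ d.F, m ≤ x := by
  obtain ⟨d, hd, E, hF, hE, -⟩ := (c.cut m).extend (fun E => E ≠ [] ∧ ∀ x ∈ E, m ≤ x) (by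
    intro g hg
    obtain ⟨E, y, h1, h2⟩ := (c.cut m).grow0 g hg
    exact ⟨E, y, h1, h2, fun x hx => (cut_iff.1 (h1.1 x hx).1).2⟩) 0
  refine ⟨d, QC.le_trans _ _ _ hd (c.cut_le m), ?_⟩
  obtain ⟨x, hx⟩ := List.exists_mem_of_ne_nil E hE.1
  exact ⟨x, by rw [hF]; exact List.mem_append_right _ hx, hE.2 x hx⟩

def QC.compat (c : QC w Z) (G : ℕ → Bool) : Prop :=
  (∀ x ∈ c.F, G x = true) ∧ (∀ x, G x = true → x ∈ c.F ∨ c.X x = true) ∧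
    Indep c.R (fun x => G x = true) ∧ Inf G

variable {ι α : Type} [Primcodable ι] [Primcodable α]

/-- bad pair of pairs -/
def Rel (q : (ℕ × ℕ) × (ℕ × ℕ)) : Prop := (q.1.1 < q.1.2 ∧ q.2.1 < q.2.2) ∧ q.1 ≠ q.2

theorem primrec_Rel : PrimrecPred Rel := by
  refine PrimrecPred.and (PrimrecPred.and ?_ ?_) (PrimrecPred.not ?_)
  · exact Primrec.nat_lt.comp (Primrec.fst.comp Primrec.fst) (Primrec.snd.comp Primrec.fst)
  · exact Primrec.nat_lt.comp (Primrec.fst.comp Primrec.snd) (Primrec.snd.comp Primrec.snd)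
  · exact Primrec.eq.comp Primrec.fst Primrec.snd

abbrev Orc := ((ℕ × ℕ) × (ℕ × ℕ)) ⊕ (ℕ ⊕ ℕ)

theorem primrec_product {β γ : Type} [Primcodable β] [Primcodable γ] {f : α → List β}
    {g : α → List γ} (hf : Primrec f) (hg : Primrec g) : Primrec fun a => (f a ×ˢ g a) := by
  have h : Primrec fun a => (f a).flatMap fun b => (g a).map fun c => (b, c) := by
    refine Primrec.list_flatMap hf (Primrec.list_map (hg.comp Primrec.fst) ?_)
    exact Primrec.pair (Primrec.snd.comp Primrec.fst) Primrec.snd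
  exact h

theorem sig_indep {L : α → List ℕ} (hL : Primrec L) :
    Sig (fun (O : Orc → Bool) a => Indep (fun p => O (Sum.inl p)) (fun z => z ∈ L a)) := by
  have h : Sig (fun (O : Orc → Bool) a => ∀ q ∈ ((L a ×ˢ L a) ×ˢ (L a ×ˢ L a)),
      ¬ Rel q ∨ O (Sum.inl q) = false) := by
    refine Sig.forall_mem (primrec_product (primrec_product hL hL) (primrec_product hL hL))
      (Sig.or (Sig.prim (primrec_Rel.not.comp Primrec.snd)) (Sig.atom ?_ (Primrec.const false)))
    exact Primrec.sumInl.comp Primrec.snd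
  refine h.of_eq fun O a => ?_
  constructor
  · intro h u v u' v' hu hv hu' hv' h1 h2 h3
    have := h ((u, v), (u', v')) (by simp only [List.mem_product]; exact ⟨⟨hu, hv⟩, hu', hv'⟩)
    exact this.resolve_left fun hn => hn ⟨⟨h1, h2⟩, h3⟩
  · rintro h ⟨⟨u, v⟩, ⟨u', v'⟩⟩ hq
    simp only [List.mem_product] at hq
    by_cases hr : Rel ((u, v), (u', v'))
    · exact Or.inr (h u v u' v' hq.1.1 hq.1.2 hq.2.1 hq.2.2 hr.1.1 hr.1.2 hr.2)
    · exact Or.inl hr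

theorem sig_ncls (k : ℕ) (F : List ℕ) :
    Sig (fun (O : Orc → Bool) (_ : α) => ¬ Cls k F (fun x => O (Sum.inr (Sum.inl x)))
      (fun p => O (Sum.inl p))) := by
  have h1 : Sig (fun (O : Orc → Bool) (_ : α) => ∃ q : (ℕ × ℕ) × (ℕ × ℕ),
      O (Sum.inl q) = true ∧ O (Sum.inl (q.2, q.1)) = false) := by
    refine Sig.ex (Sig.and (Sig.atom ?_ (Primrec.const true)) (Sig.atom ?_ (Primrec.const false)))
    · exact Primrec.sumInl.comp Primrec.snd
    · exact Primrec.sumInl.comp (Primrec.pair (Primrec.snd.comp Primrec.snd)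
        (Primrec.fst.comp Primrec.snd))
  have h2 : Sig (fun (O : Orc → Bool) (_ : α) => ∃ s : (ℕ × ℕ) × List (ℕ × ℕ),
      (∀ t ∈ (List.range s.2.length ×ˢ List.range s.2.length),
        t.1 = t.2 ∨ s.2[t.1]? ≠ s.2[t.2]?) ∧ (∀ q ∈ s.2, O (Sum.inl (s.1, q)) = true) ∧
        k < s.2.length) := by
    refine Sig.ex (Sig.and (Sig.forall_mem ?_ (Sig.prim ?_)) (Sig.and (Sig.forall_mem ?_ 
      (Sig.atom ?_ (Primrec.const true))) (Sig.prim ?_)))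
    · have : Primrec fun p : α × ((ℕ × ℕ) × List (ℕ × ℕ)) => List.range p.2.2.length :=
        Primrec.list_range.comp (Primrec.list_length.comp (Primrec.snd.comp Primrec.snd))
      exact primrec_product this this
    · have hs : Primrec fun p : (α × ((ℕ × ℕ) × List (ℕ × ℕ))) × (ℕ × ℕ) => p.1.2.2 :=
        Primrec.snd.comp (Primrec.snd.comp Primrec.fst)
      refine PrimrecPred.or ?_ (PrimrecPred.not ?_)
      · exact Primrec.eq.comp (Primrec.fst.comp Primrec.snd) (Primrec.snd.comp Primrec.snd)
      · exact Primrec.eq.comp (Primrec.list_getElem?.comp hs (Primrec.fst.comp Primrec.snd))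
          (Primrec.list_getElem?.comp hs (Primrec.snd.comp Primrec.snd))
    · exact Primrec.snd.comp Primrec.snd
    · exact Primrec.sumInl.comp (Primrec.pair (Primrec.fst.comp (Primrec.snd.comp Primrec.fst))
        Primrec.snd)
    · exact Primrec.nat_lt.comp (Primrec.const k)
        (Primrec.list_length.comp (Primrec.snd.comp Primrec.snd))
  have h3 : Sig (fun (O : Orc → Bool) (_ : α) => ∃ s : ℕ × ((ℕ × ℕ) × (ℕ × ℕ)),
      O (Sum.inr (Sum.inl s.1)) = true ∧ (s.2 ∈ (((F ++ [s.1]) ×ˢ (F ++ [s.1])) ×ˢ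
        ((F ++ [s.1]) ×ˢ (F ++ [s.1]))) ∧ Rel s.2) ∧ O (Sum.inl s.2) = true) := by
    refine Sig.ex (Sig.and (Sig.atom ?_ (Primrec.const true)) (Sig.and (Sig.and (Sig.prim ?_)
      (Sig.prim ?_)) (Sig.atom ?_ (Primrec.const true))))
    · exact Primrec.sumInr.comp (Primrec.sumInl.comp (Primrec.fst.comp Primrec.snd))
    · have hl : Primrec fun p : α × (ℕ × ((ℕ × ℕ) × (ℕ × ℕ))) => F ++ [p.2.1] :=
        Primrec.list_append.comp (Primrec.const F) (Primrec.list_cons.comp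
          (Primrec.fst.comp Primrec.snd) (Primrec.const []))
      have hm : ∀ {f : α × (ℕ × ((ℕ × ℕ) × (ℕ × ℕ))) → ℕ}, Primrec f →
          PrimrecPred fun p => f p ∈ F ++ [p.2.1] := fun hf => primrec_mem.comp hf hl
      have hq : Primrec fun p : α × (ℕ × ((ℕ × ℕ) × (ℕ × ℕ))) => p.2.2 :=
        Primrec.snd.comp Primrec.snd
      refine PrimrecPred.of_eq (((hm (Primrec.fst.comp (Primrec.fst.comp hq))).and
        (hm (Primrec.snd.comp (Primrec.fst.comp hq)))).and
        ((hm (Primrec.fst.comp (Primrec.snd.comp hq))).and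
        (hm (Primrec.snd.comp (Primrec.snd.comp hq))))) ?_
      rintro ⟨_, _, ⟨⟨_, _⟩, ⟨_, _⟩⟩⟩
      simp only [List.mem_product]
    · exact primrec_Rel.comp (Primrec.snd.comp Primrec.snd)
    · exact Primrec.sumInl.comp (Primrec.snd.comp Primrec.snd)
  refine (h1.or (h2.or h3)).of_eq fun O a => ?_
  constructor
  · rintro (⟨⟨p, q⟩, ha, hb⟩ | ⟨⟨p, L⟩, ha, hb, hc⟩ | ⟨⟨x, q⟩, ha, ⟨hb, hc⟩, hd⟩) ⟨c1, c2, c3⟩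
    · have hb' : O (Sum.inl (q, p)) = false := hb
      have := c1 p q ha
      simp only [hb'] at this
      exact absurd this (by simp)
    · have := c2 p L ?_ hb
      · simp only at hc
        omega
      · rw [List.nodup_iff_getElem?_ne_getElem?]
        intro i j hij hj
        refine (ha (i, j) ?_).resolve_left ?_
        · simp only [List.mem_product, List.mem_range]
          exact ⟨by omega, hj⟩
        · simp only
          omega
    · obtain ⟨⟨u, v⟩, ⟨u', v'⟩⟩ := q
      simp only [List.mem_product] at hb
      have := c3 x ha u v u' v' hb.1.1 hb.1.2 hb.2.1 hb.2.2 hc.1.1 hc.1.2 hc.2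
      simp only [this] at hd
      exact absurd hd (by simp)
  · intro hn
    by_contra hcon
    rw [not_or, not_or] at hcon
    obtain ⟨n1, n2, n3⟩ := hcon
    refine hn ⟨?_, ?_, ?_⟩
    · intro p q hpq
      by_contra hne
      exact n1 ⟨(p, q), hpq, by simpa using hne⟩
    · intro p L hL hq
      by_contra hlt
      refine n2 ⟨(p, L), ?_, hq, by simpa using hlt⟩
      rintro ⟨i, j⟩ hij
      simp only [List.mem_product, List.mem_range] at hij
      by_cases h : i = j
      · exact Or.inl h
      · right
        rw [List.nodup_iff_getElem?_ne_getElem?] at hL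
        rcases lt_or_gt_of_ne h with h | h
        · exact hL i j h hij.2
        · exact (hL j i h hij.1).symm
    · intro x hx u v u' v' hu hv hu' hv' e1 e2 e3
      by_contra hne
      refine n3 ⟨(x, ((u, v), (u', v'))), hx, ⟨?_, ⟨e1, e2⟩, e3⟩, by simpa using hne⟩
      simp only [List.mem_product]
      exact ⟨⟨hu, hv⟩, hu', hv'⟩

theorem QC.force (c : QC w Z) (S : (ℕ ⊕ ℕ → Bool) → ℕ × Bool → Prop) (hS : Sig S) :
    ∃ d : QC w Z, d.le c ∧ ∀ G, d.compat G → ¬ ∀ n b, S (Sum.elim G Z) (n, b) ↔ w n = b := by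
  let T : (Orc → Bool) → ℕ × Bool → Prop := fun O a => ∃ s : List ℕ × ℕ,
    ((∀ x ∈ s.1, O (Sum.inr (Sum.inl x)) = true ∧ x < s.2) ∧
      O (Sum.inr (Sum.inl s.2)) = true ∧
      Indep (fun p => O (Sum.inl p)) (fun z => z ∈ c.F ++ s.1 ++ [s.2])) ∧
    S (Sum.elim (lst (c.F ++ s.1)) (fun k => O (Sum.inr (Sum.inr k)))) a
  have hT : Sig T := by
    have hl : Primrec fun p : (ℕ × Bool) × (List ℕ × ℕ) => c.F ++ p.2.1 :=
      Primrec.list_append.comp (Primrec.const _) (Primrec.fst.comp Primrec.snd)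
    refine Sig.ex (Sig.and (Sig.and (Sig.forall_mem (Primrec.fst.comp Primrec.snd) (Sig.and
      (Sig.atom ?_ (Primrec.const true)) (Sig.prim ?_))) (Sig.and (Sig.atom ?_ (Primrec.const true))
      (sig_indep ?_))) (sig_fin hS hl ?_ Primrec.fst))
    · exact Primrec.sumInr.comp (Primrec.sumInl.comp Primrec.snd)
    · exact Primrec.nat_lt.comp Primrec.snd (Primrec.snd.comp (Primrec.snd.comp Primrec.fst))
    · exact Primrec.sumInr.comp (Primrec.sumInl.comp (Primrec.snd.comp Primrec.snd))
    · exact Primrec.list_append.comp hl (Primrec.list_cons.comp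
        (Primrec.snd.comp Primrec.snd) (Primrec.const []))
    · exact Primrec.sumInr.comp Primrec.sumInr
  have hT' : Sig (fun (A : ℕ ⊕ ℕ → Bool) (a : ℕ × Bool) => ∀ g : Cst,
      (¬ Cls (2 * c.k) c.F (fun x => (Sum.elim g A) (Sum.inr (Sum.inl x)))
        (fun p => (Sum.elim g A) (Sum.inl p))) ∨ T (Sum.elim g A) a) :=
    Sig.all (S := fun (O : Orc → Bool) a => (¬ Cls (2 * c.k) c.F
      (fun x => O (Sum.inr (Sum.inl x))) (fun p => O (Sum.inl p))) ∨ T O a)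
      ((sig_ncls _ _).or hT)
  rcases c.good.dich hT' with ⟨n, b, hP, hne⟩ | ⟨n, hNg⟩
  · obtain ⟨d0, hd0, E0, hF0, hΨ0, -⟩ := c.extend
      (fun E => S (Sum.elim (lst (c.F ++ E)) Z) (n, b)) (by
        intro g hg
        obtain ⟨⟨E, y⟩, h1, h2⟩ := (hP g).resolve_left (fun hn => hn hg)
        exact ⟨E, y, h1, h2⟩) 0
    obtain ⟨m, hm⟩ := use_left hS hΨ0
    refine ⟨d0.cut m, QC.le_trans _ _ _ (d0.cut_le m) hd0, fun G hG hcon => ?_⟩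
    refine hne ((hcon n b).1 (hm G ?_))
    intro x hx
    rw [Bool.eq_iff_iff, lst_iff, ← hF0]
    constructor
    · intro h
      rcases hG.2.1 x h with h | h
      · exact h
      · have := (cut_iff.1 h).2
        omega
    · exact hG.1 x
  · rw [not_forall] at hNg
    obtain ⟨g, hg⟩ := hNg
    rw [not_or, not_not] at hg
    obtain ⟨hcls, hnT⟩ := hg
    have hcls : Cls (2 * c.k) c.F c.X g := hcls
    refine ⟨⟨c.F, fun p => c.R p || g p, c.k + 2 * c.k, c.X, ⟨?_, ?_, ?_⟩, c.inf, c.good, c.lt⟩,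
      ⟨fun _ h => h, fun _ h => Or.inl h, fun _ h => h, fun p h => by simp [h]⟩, ?_⟩
    · intro p q h
      simp only [Bool.or_eq_true] at h ⊢
      exact h.imp (c.cls.1 _ _) (hcls.1 _ _)
    · intro p L hL hR
      have hlen := List.length_eq_length_filter_add (l := L) (fun q => c.R (p, q))
      have ha := c.cls.2.1 p _ (hL.filter fun q => c.R (p, q))
        (fun q hq => (List.mem_filter.1 hq).2)
      have hb := hcls.2.1 p _ (hL.filter fun q => !c.R (p, q)) (fun q hq => by
        obtain ⟨h1, h2⟩ := List.mem_filter.1 hq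
        have := hR q h1
        cases h : c.R (p, q) <;> simp_all)
      omega
    · intro x hx u v u' v' hu hv hu' hv' e1 e2 e3
      have h1 := c.cls.2.2 x hx u v u' v' hu hv hu' hv' e1 e2 e3
      have h2 := hcls.2.2 x hx u v u' v' hu hv hu' hv' e1 e2 e3
      simp [h1, h2]
    · intro G hG hcon
      obtain ⟨hG1, hG2, hG3, hG4⟩ := hG
      have hSG := (hcon n (w n)).2 rfl
      obtain ⟨m, hm⟩ := use_left hS hSG
      obtain ⟨m2, hm2⟩ := exists_bd c.F
      obtain ⟨y, hy, hyG⟩ := hG4 (m + m2)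
      have hyX : c.X y = true := by
        rcases hG2 y hyG with h | h
        · have := hm2 y h; omega
        · exact h
      refine hnT ⟨((List.range m).filter (fun x => G x && c.X x), y), ⟨?_, hyX, ?_⟩, hm _ ?_⟩
      · intro x hx
        simp only [List.mem_filter, List.mem_range, Bool.and_eq_true] at hx
        exact ⟨hx.2.2, by show x < y; omega⟩
      · refine hG3.mono (fun p hp => ?_) ?_
        · have hp : g p = true := hp
          show (c.R p || g p) = true
          simp [hp]
        · intro x hx
          simp only [List.mem_append, List.mem_filter, List.mem_range, Bool.and_eq_true,
            List.mem_singleton] at hx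
          rcases hx with (hx | hx) | rfl
          · exact hG1 x hx
          · exact hx.2.1
          · exact hyG
      · intro x hx
        rw [Bool.eq_iff_iff, lst_iff, List.mem_append]
        constructor
        · rintro (h | h)
          · exact hG1 x h
          · simp only [List.mem_filter, Bool.and_eq_true] at h
            exact h.2.1
        · intro h
          rcases hG2 x h with h' | h'
          · exact Or.inl h'
          · right
            have h' : c.X x = true := h'
            simp only [List.mem_filter, List.mem_range, h, h']
            exact ⟨hx, rfl⟩

theorem main_good (c0 : QC w Z) : ∃ G, Inf G ∧ Good w (Sum.elim G Z) ∧
    Indep c0.R (fun x => G x = true) := by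
  classical
  obtain ⟨e, he, hall⟩ := exists_enum_sig (ι := ℕ ⊕ ℕ) (α := ℕ × Bool)
  obtain ⟨s, h0, hdec, hD⟩ := exists_seq (C := QC w Z) QC.le QC.le_refl QC.le_trans
    (fun k d => (∃ x ∈ d.F, k ≤ x) ∧ ∀ G, d.compat G →
      ¬ ∀ n b, e k (Sum.elim G Z) (n, b) ↔ w n = b) (by
    intro k c
    obtain ⟨d1, h1, x1, hx1, hk1⟩ := c.grow k
    obtain ⟨d2, h2, h3⟩ := d1.force (e k) (he k)
    exact ⟨d2, QC.le_trans _ _ _ h2 h1, ⟨x1, h2.1 _ hx1, hk1⟩, h3⟩) c0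
  let G : ℕ → Bool := fun x => decide (∃ k, x ∈ (s k).F)
  have hGi : ∀ x, G x = true ↔ ∃ k, x ∈ (s k).F := by intro x; simp [G]
  have hInf : Inf G := by
    intro m
    obtain ⟨x, hx, hm⟩ := (hD m).1
    exact ⟨x, hm, (hGi x).2 ⟨_, hx⟩⟩
  have hI : ∀ k, Indep (s k).R (fun x => G x = true) := by
    intro k u v u' v' hu hv hu' hv' e1 e2 e3
    obtain ⟨k1, h1⟩ := (hGi _).1 hu
    obtain ⟨k2, h2⟩ := (hGi _).1 hv
    obtain ⟨k3, h3⟩ := (hGi _).1 hu'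
    obtain ⟨k4, h4⟩ := (hGi _).1 hv'
    let K := k + k1 + k2 + k3 + k4
    have h1 := (hdec k1 K (by omega)).1 _ h1
    have h2 := (hdec k2 K (by omega)).1 _ h2
    have h3 := (hdec k3 K (by omega)).1 _ h3
    have h4 := (hdec k4 K (by omega)).1 _ h4
    obtain ⟨x, -, hx⟩ := (s K).inf 0
    have := (s K).cls.2.2 x hx u v u' v' (List.mem_append_left _ h1) (List.mem_append_left _ h2)
      (List.mem_append_left _ h3) (List.mem_append_left _ h4) e1 e2 e3
    by_contra hne
    have h5 := (hdec k K (by omega)).2.2.2 _ (by simpa using hne)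
    rw [this] at h5
    exact absurd h5 (by simp)
  have hcompat : ∀ k, (s k).compat G := by
    intro k
    refine ⟨fun x hx => (hGi x).2 ⟨k, hx⟩, fun x hx => ?_, hI k, hInf⟩
    obtain ⟨j, hj⟩ := (hGi x).1 hx
    rcases le_total j k with h | h
    · exact Or.inl ((hdec j k h).1 x hj)
    · exact (hdec k j h).2.1 x hj
  refine ⟨G, hInf, ?_, ?_⟩
  · intro S hS hcon
    obtain ⟨k, rfl⟩ := hall S hS
    exact (hD k).2 G (hcompat _) hcon
  · have := hI 0
    rw [h0] at this
    exact this

theorem good_start {W Z : Set ℕ} (h : ¬ TuringLE W Z) :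
    Good (bo W) (Sum.elim (fun _ : ℕ => true) (bo Z)) := by
  have h1 : Good (bo W) (bo Z) := fun S hS hcon => h (sig_turingLE hS hcon)
  refine h1.map (κ := ℕ ⊕ ℕ) (fun O => Sum.elim (fun _ => true) O) ?_
  have h2 : Sig (fun (_ : ℕ → Bool) (p : Unit × (ℕ × Bool)) => true = p.2.2) :=
    Sig.prim (Primrec.eq.comp (Primrec.const true) (Primrec.snd.comp Primrec.snd))
  have h3 : Sig (fun (O : ℕ → Bool) (p : Unit × (ℕ × Bool)) => O p.2.1 = p.2.2) :=
    Sig.atom (Primrec.fst.comp Primrec.snd) (Primrec.snd.comp Primrec.snd)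
  exact (Sig.sumElim (f := fun (_ : ℕ → Bool) (_ : Unit) (_ : ℕ) => true)
    (g := fun O _ k => O k) h2 h3).comp
    (f := fun p => ((), p)) (Primrec.pair (Primrec.const ()) Primrec.id)

theorem not_turingLE_of_good {W Z : Set ℕ} {G : ℕ → Bool}
    (h : Good (bo W) (Sum.elim G (bo Z))) :
    ¬ TuringLE W (join {x | G x = true} Z) := by
  intro hle
  obtain ⟨S, hS, hSW⟩ := recIn_sig hle
  have hjoin : bo (join {x | G x = true} Z) = fun n => if n % 2 = 0 then
      (Sum.elim G (bo Z) : ℕ ⊕ ℕ → Bool) (Sum.inl (n / 2)) else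
      (Sum.elim G (bo Z) : ℕ ⊕ ℕ → Bool) (Sum.inr (n / 2)) := by
    funext n
    rw [Bool.eq_iff_iff]
    rcases Nat.even_or_odd' n with ⟨m, rfl | rfl⟩
    · have : ∀ k, 2 * m = 2 * k ↔ k = m := by intro k; omega
      have h2 : ∀ k, 2 * m ≠ 2 * k + 1 := by intro k; omega
      simp [bo, join, this, h2]
    · have h1 : ∀ k, 2 * m + 1 = 2 * k + 1 ↔ k = m := by intro k; omega
      have h2 : ∀ k, 2 * m + 1 ≠ 2 * k := by intro k; omega
      have h3 : (2 * m + 1) / 2 = m := by omega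
      have h4 : (2 * m + 1) % 2 = 1 := by omega
      simp only [h3, h4, one_ne_zero, if_false, Sum.elim_inr]
      simp only [bo, decide_eq_true_eq]
      constructor
      · rintro (⟨k, _, hk⟩ | ⟨k, hk, hk'⟩)
        · exact absurd hk (h2 k)
        · rwa [← (h1 k).1 hk']
      · intro hm
        exact Or.inr ⟨m, hm, rfl⟩
  have hgood : Good (bo W) (bo (join {x | G x = true} Z)) := by
    rw [hjoin]
    refine h.map (fun O n => if n % 2 = 0 then O (Sum.inl (n / 2)) else O (Sum.inr (n / 2))) ?_
    have hm : PrimrecPred fun p : ℕ × Bool => p.1 % 2 = 0 :=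
      Primrec.eq.comp (Primrec.nat_mod.comp Primrec.fst (Primrec.const 2)) (Primrec.const 0)
    have hd : Primrec fun p : ℕ × Bool => p.1 / 2 :=
      Primrec.nat_div.comp Primrec.fst (Primrec.const 2)
    refine (Sig.or (Sig.and (Sig.prim hm) (Sig.atom (Primrec.sumInl.comp hd) Primrec.snd))
      (Sig.and (Sig.prim hm.not) (Sig.atom (Primrec.sumInr.comp hd) Primrec.snd))).of_eq ?_
    rintro A ⟨n, b⟩
    by_cases hn : n % 2 = 0 <;> simp [hn]
  refine hgood (fun O a => S O (a.1, a.2.toNat)) ?_ ?_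
  · exact hS.comp (Primrec.pair Primrec.fst ((Primrec.dom_finite Bool.toNat).comp Primrec.snd))
  · intro n b
    show S _ (n, b.toNat) ↔ _
    rw [← hSW]
    refine Iff.trans Part.mem_some_iff ?_
    rw [chi_eq]
    cases b <;> cases bo W n <;> simp

open Classical in
noncomputable def Rf (f : ℕ → ℕ → ℕ) : Cst := fun p =>
  decide ((p.1.1 < p.1.2 ∧ p.2.1 < p.2.2) ∧ f p.1.1 p.1.2 = f p.2.1 p.2.2)

theorem Rf_iff {f : ℕ → ℕ → ℕ} {p : (ℕ × ℕ) × (ℕ × ℕ)} : Rf f p = true ↔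
    (p.1.1 < p.1.2 ∧ p.2.1 < p.2.2) ∧ f p.1.1 p.1.2 = f p.2.1 p.2.2 := by
  simp [Rf]

theorem deg_Rf {f : ℕ → ℕ → ℕ} (hf : Bounded2Pairs f) : Deg (Rf f) 2 := by
  classical
  intro p L hL hR
  have h1 := hf (f p.1 p.2)
  have hsub : (L.toFinset : Set (ℕ × ℕ)) ⊆ {q : ℕ × ℕ | q.1 < q.2 ∧ f q.1 q.2 = f p.1 p.2} := by
    intro q hq
    have := Rf_iff.1 (hR q (by simpa using hq))
    exact ⟨this.1.2, this.2.symm⟩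
  have h2 := (Set.encard_le_encard hsub).trans h1
  rw [Set.encard_coe_eq_coe_finsetCard, List.toFinset_card_of_nodup hL] at h2
  exact_mod_cast h2

theorem main_thm (W Z : Set ℕ) (hWZ : ¬ TuringLE W Z) (f : ℕ → ℕ → ℕ)
    (hbounded : Bounded2Pairs f) :
    ∃ H : Set ℕ, H.Infinite ∧ RainbowOn f H ∧ ¬ TuringLE W (join H Z) := by
  have hc : Cls 2 [] (fun _ => true) (Rf f) := by
    refine ⟨?_, deg_Rf hbounded, ?_⟩
    · intro p q h
      rw [Rf_iff] at h ⊢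
      exact ⟨⟨h.1.2, h.1.1⟩, h.2.symm⟩
    · intro x _ a b c d ha hb _ _ hab _ _
      simp only [List.nil_append, List.mem_singleton] at ha hb
      omega
  obtain ⟨G, h1, h2, h3⟩ := main_good (w := bo W) (Z := bo Z)
    ⟨[], Rf f, 2, fun _ => true, hc, fun m => ⟨m, le_rfl, rfl⟩,
      good_start hWZ, by simp⟩
  · refine ⟨{x | G x = true}, ?_, ?_, not_turingLE_of_good h2⟩
    · refine Set.infinite_of_forall_exists_gt fun m => ?_
      obtain ⟨x, hx, hX⟩ := h1 (m + 1)
      exact ⟨x, hX, by omega⟩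
    · intro x₀ x₁ y₀ y₁ hx0 hx1 hy0 hy1 hx hy he
      by_contra hne
      have := h3 x₀ x₁ y₀ y₁ hx0 hx1 hy0 hy1 hx hy (fun h => hne (Prod.mk.inj h))
      rw [Bool.eq_false_iff, Ne, Rf_iff] at this
      exact this ⟨⟨hx, hy⟩, he⟩

end Final
end RRT

namespace RRT

/-- if `W ≰_T Z`, then every 2-bounded coloring `f` of `[ℕ]²` (of arbitrary
complexity) admits an infinite `f`-rainbow `H` with `W ≰_T H ⊕ Z`. -/
theorem statement2 (W Z : Set ℕ) (hWZ : ¬ TuringLE W Z) (f : ℕ → ℕ → ℕ)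
    (hbounded : Bounded2Pairs f) :
    ∃ H : Set ℕ, H.Infinite ∧ RainbowOn f H ∧ ¬ TuringLE W (join H Z) := by
  exact main_thm W Z hWZ f hbounded

end RRT
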